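/- arXiv:1904.06803 — 13 statements merged into one kernel-verified Lean document; each statement's English description precedes it below -/
import Mathlib

section
/- Let n be a positive integer and let 𝒜 and ℬ be subalgebras of M_n(ℂ). If 𝒜 and ℬ are transpose similar (i.e., 𝒜 or its transpose 𝒜ᵀ = {Aᵀ : A ∈ 𝒜} is similar to ℬ), then 𝒜 is idempotent compressible if and only if ℬ is idempotent compressible. -/
open Matrix

abbrev Mat (n : ℕ) := Matrix (Fin n) (Fin n) ℂ

/-- A set of matrices is closed under multiplication. -/
def MulClosed {n : ℕ} (S : Set (Mat n)) : Prop :=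
  ∀ x ∈ S, ∀ y ∈ S, x * y ∈ S

/-- The compression `E 𝒜 E = {E A E : A ∈ 𝒜}` of a set of matrices by `E`. -/
def compress {n : ℕ} (E : Mat n) (A : Set (Mat n)) : Set (Mat n) :=
  (fun M => E * M * E) '' A

/-- `𝒜` is projection compressible: for every orthogonal projection `P`,
`P 𝒜 P` is closed under multiplication. -/
def ProjectionCompressible {n : ℕ} (A : Set (Mat n)) : Prop :=
  ∀ P : Mat n, P * P = P → Pᴴ = P → MulClosed (compress P A)

/-- `𝒜` is idempotent compressible: for every idempotent `E`,
`E 𝒜 E` is closed under multiplication. -/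
def IdempotentCompressible {n : ℕ} (A : Set (Mat n)) : Prop :=
  ∀ E : Mat n, E * E = E → MulClosed (compress E A)

theorem IdempotentCompressible.transpose {n : ℕ} {A : Set (Mat n)}
    (h : IdempotentCompressible A) : IdempotentCompressible ((·ᵀ) '' A) := by
  rintro E hE _ ⟨_, ⟨a, ha, rfl⟩, rfl⟩ _ ⟨_, ⟨b, hb, rfl⟩, rfl⟩
  have hE' : Eᵀ * Eᵀ = Eᵀ := by rw [← transpose_mul, hE]
  obtain ⟨c, hc, hcc⟩ := h Eᵀ hE' _ ⟨b, hb, rfl⟩ _ ⟨a, ha, rfl⟩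
  refine ⟨_, ⟨c, hc, rfl⟩, ?_⟩
  simpa [transpose_mul, Matrix.mul_assoc] using congrArg Matrix.transpose hcc

theorem idempotentCompressible_transpose_iff {n : ℕ} {A : Set (Mat n)} :
    IdempotentCompressible ((·ᵀ) '' A) ↔ IdempotentCompressible A :=
  ⟨fun h => by simpa [Set.image_image] using h.transpose, fun h => h.transpose⟩

theorem IdempotentCompressible.image_mulEquiv {n : ℕ} {A : Set (Mat n)}
    (h : IdempotentCompressible A) (φ : Mat n ≃* Mat n) :
    IdempotentCompressible (φ '' A) := by
  rintro E hE _ ⟨_, ⟨a, ha, rfl⟩, rfl⟩ _ ⟨_, ⟨b, hb, rfl⟩, rfl⟩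
  have hE' : φ.symm E * φ.symm E = φ.symm E := by rw [← map_mul, hE]
  obtain ⟨c, hc, hcc⟩ := h _ hE' _ ⟨a, ha, rfl⟩ _ ⟨b, hb, rfl⟩
  refine ⟨_, ⟨c, hc, rfl⟩, ?_⟩
  simpa using congrArg φ hcc

theorem idempotentCompressible_image_mulEquiv_iff {n : ℕ} {A : Set (Mat n)}
    (φ : Mat n ≃* Mat n) :
    IdempotentCompressible (φ '' A) ↔ IdempotentCompressible A :=
  ⟨fun h => by simpa [Set.image_image] using h.image_mulEquiv φ.symm,
    fun h => h.image_mulEquiv φ⟩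

/-- Conjugation by a unit, as a multiplicative automorphism. -/
def conjMulEquiv {M : Type*} [Monoid M] (u : Mˣ) : M ≃* M where
  toFun x := ↑u⁻¹ * x * u
  invFun x := u * x * ↑u⁻¹
  left_inv x := by simp [mul_assoc]
  right_inv x := by simp [mul_assoc]
  map_mul' x y := by simp [mul_assoc]

theorem idempotentCompressible_conj_iff {n : ℕ} {A : Set (Mat n)} {S : Mat n}
    (hS : IsUnit S) :
    IdempotentCompressible ((fun M => S⁻¹ * M * S) '' A) ↔ IdempotentCompressible A := by
  obtain ⟨u, rfl⟩ := hS
  rw [← coe_units_inv]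
  exact idempotentCompressible_image_mulEquiv_iff (conjMulEquiv u)

/-- If subalgebras `𝒜` and `ℬ` of `Mₙ(ℂ)` are transpose similar (`𝒜` or `𝒜ᵀ` is
similar to `ℬ`), then `𝒜` is idempotent compressible iff `ℬ` is. -/
theorem transpose_similar_idempotent_compressible
    {n : ℕ} (hn : 0 < n) (A B : NonUnitalSubalgebra ℂ (Mat n))
    (hAB : ∃ S : Mat n, IsUnit S ∧
      ((B : Set (Mat n)) = (fun M => S⁻¹ * M * S) '' (A : Set (Mat n)) ∨
       (B : Set (Mat n)) = (fun M => S⁻¹ * M * S) '' ((·ᵀ) '' (A : Set (Mat n))))) :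
    IdempotentCompressible (A : Set (Mat n)) ↔ IdempotentCompressible (B : Set (Mat n)) := by
  obtain ⟨S, hS, hB | hB⟩ := hAB
  · rw [hB, idempotentCompressible_conj_iff hS]
  · rw [hB, idempotentCompressible_conj_iff hS, idempotentCompressible_transpose_iff]
end

section
/- If 𝒜 is a projection compressible subalgebra of M_n(ℂ), then its unitization 𝒜̃ := 𝒜 + ℂI = {A + αI : A ∈ 𝒜, α ∈ ℂ} is projection compressible. Likewise, if 𝒜 is idempotent compressible, then 𝒜̃ is idempotent compressible. -/
open Matrix

/-- The unitization `𝒜 + ℂ I` of a set of matrices. -/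
def unitization {n : ℕ} (A : Set (Mat n)) : Set (Mat n) :=
  {M | ∃ B ∈ A, ∃ α : ℂ, M = B + α • (1 : Mat n)}

theorem MulClosed.compress_unitization {n : ℕ} (A : NonUnitalSubalgebra ℂ (Mat n)) {E : Mat n}
    (hE : E * E = E) (h : MulClosed (compress E (A : Set (Mat n)))) :
    MulClosed (compress E (unitization (A : Set (Mat n)))) := by
  rintro _ ⟨_, ⟨B, hB, α, rfl⟩, rfl⟩ _ ⟨_, ⟨C, hC, β, rfl⟩, rfl⟩
  obtain ⟨D, hD, hDE⟩ := h _ ⟨B, hB, rfl⟩ _ ⟨C, hC, rfl⟩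
  refine ⟨_, ⟨D + α • C + β • B,
    add_mem (add_mem hD (A.smul_mem α hC)) (A.smul_mem β hB), α * β, rfl⟩, ?_⟩
  have compress_add_smul_one (M : Mat n) (γ : ℂ) :
      E * (M + γ • 1) * E = E * M * E + γ • E := by
    simp [mul_add, add_mul, hE]
  have left_absorb (M : Mat n) : E * (E * M * E) = E * M * E := by
    simp only [← mul_assoc, hE]
  have right_absorb (M : Mat n) : E * M * E * E = E * M * E := by
    rw [mul_assoc, hE]
  dsimp only at hDE ⊢
  rw [compress_add_smul_one, compress_add_smul_one, compress_add_smul_one]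
  simp only [mul_add, add_mul, smul_mul_assoc, mul_smul_comm, left_absorb, right_absorb, hE,
    hDE, smul_smul, smul_add]
  rw [mul_comm β α]
  abel

/-- If `𝒜` is projection (resp. idempotent) compressible, then so is its unitization. -/
theorem unitization_compressible {n : ℕ} (A : NonUnitalSubalgebra ℂ (Mat n)) :
    (ProjectionCompressible (A : Set (Mat n)) →
      ProjectionCompressible (unitization (A : Set (Mat n)))) ∧
    (IdempotentCompressible (A : Set (Mat n)) →
      IdempotentCompressible (unitization (A : Set (Mat n)))) := by
  exact ⟨fun h P hP hP' => (h P hP hP').compress_unitization A hP,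
    fun h E hE => (h E hE).compress_unitization A hE⟩
end

section
/- For any orthogonal projections P and Q in M_n(ℂ), the subalgebra P·M_n(ℂ)·Q = {PTQ : T ∈ M_n(ℂ)} is idempotent compressible. -/
open Matrix

/-- Every `LR`-algebra `P Mₙ(ℂ) Q` (with `P`, `Q` orthogonal projections)
is idempotent compressible. -/
theorem LR_algebra_idempotent_compressible {n : ℕ} (P Q : Mat n)
    (hP : P * P = P) (hP' : Pᴴ = P) (hQ : Q * Q = Q) (hQ' : Qᴴ = Q) :
    IdempotentCompressible {M : Mat n | ∃ T : Mat n, M = P * T * Q} := by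
  rintro E hE _ ⟨_, ⟨T, rfl⟩, rfl⟩ _ ⟨_, ⟨S, rfl⟩, rfl⟩
  refine ⟨P * (T * Q * E * P * S) * Q, ⟨_, rfl⟩, ?_⟩
  calc E * (P * (T * Q * E * P * S) * Q) * E
      = E * P * T * Q * E * P * S * Q * E := by simp only [Matrix.mul_assoc]
    _ = E * P * T * Q * (E * E) * P * S * Q * E := by rw [hE]
    _ = E * (P * T * Q) * E * (E * (P * S * Q) * E) := by simp only [Matrix.mul_assoc]
end

section
/- Let n ≥ 3 be an integer and let Q₁, Q₂, Q₃ be orthogonal projections in M_n(ℂ) with Q₁ + Q₂ + Q₃ = I. Then the subalgebra 𝒜 := ℂQ₁ + (Q₁+Q₂)·M_n(ℂ)·(Q₂+Q₃) = {αQ₁ + (Q₁+Q₂)T(Q₂+Q₃) : α ∈ ℂ, T ∈ M_n(ℂ)} is idempotent compressible, and consequently its unitization 𝒜 + ℂI is idempotent compressible. -/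
open Matrix

/-- The unitization of an idempotent compressible linear space of matrices is idempotent
compressible. -/
lemma IdempotentCompressible.unitization {n : ℕ} {A : Set (Mat n)}
    (hA : IdempotentCompressible A)
    (hadd : ∀ B ∈ A, ∀ C ∈ A, B + C ∈ A) (hsmul : ∀ (c : ℂ), ∀ B ∈ A, c • B ∈ A) :
    IdempotentCompressible (unitization A) := by
  rintro E hE _ ⟨_, ⟨B, hB, β, rfl⟩, rfl⟩ _ ⟨_, ⟨C, hC, γ, rfl⟩, rfl⟩
  obtain ⟨D, hD, hBC⟩ := hA E hE _ ⟨B, hB, rfl⟩ _ ⟨C, hC, rfl⟩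
  refine ⟨D + (γ • B + β • C) + (β * γ) • 1,
    ⟨_, hadd _ hD _ (hadd _ (hsmul γ _ hB) _ (hsmul β _ hC)), β * γ, rfl⟩, ?_⟩
  have hEE (X : Mat n) : E * (E * X) = E * X := by rw [← mul_assoc, hE]
  simp only [mul_assoc, hEE] at hBC
  simp only [mul_add, add_mul, mul_smul_comm, smul_mul_assoc, mul_one, mul_assoc, hEE,
    hE, hBC]
  module

/-- If `R` is idempotent with complement `Q` and `P Q = Q`, then `ℂQ + P Mₙ(ℂ) R` is idempotent
compressible. -/
lemma idempotentCompressible_smul_add_mul {n : ℕ} {P Q R : Mat n}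
    (hR : R * R = R) (hPQ : P * Q = Q) (hQR : Q + R = 1) :
    IdempotentCompressible
      {M : Mat n | ∃ (α : ℂ) (T : Mat n), M = α • Q + P * T * R} := by
  rintro E hE _ ⟨_, ⟨α, T, rfl⟩, rfl⟩ _ ⟨_, ⟨β, S, rfl⟩, rfl⟩
  refine ⟨_, ⟨α * β, β • T - β • ((α • Q + T * R) * E * R) + (α • Q + T * R) * E * P * S, rfl⟩, ?_⟩
  have hEE (X : Mat n) : E * (E * X) = E * X := by rw [← mul_assoc, hE]
  have hRR (X : Mat n) : R * (R * X) = R * X := by rw [← mul_assoc, hR]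
  have hPQX (X : Mat n) : P * (Q * X) = Q * X := by rw [← mul_assoc, hPQ]
  have hQX (Y : Mat n) : Y * (E * (Q * E)) = Y * E - Y * (E * (R * E)) := by
    rw [eq_sub_of_add_eq hQR, sub_mul, one_mul, mul_sub, hE, mul_sub]
  have hQE (X : Mat n) : X * (Q * (E * (Q * E))) = X * (Q * E) - X * (Q * (E * (R * E))) := by
    rw [hQX, mul_sub]
  have hPRE (X Y Z : Mat n) : X * (Y * (Z * (R * (E * (Q * E))))) =
      X * (Y * (Z * (R * E))) - X * (Y * (Z * (R * (E * (R * E))))) := by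
    rw [hQX, mul_sub, mul_sub, mul_sub]
  simp only [mul_add, add_mul, mul_sub, sub_mul, mul_smul_comm, smul_mul_assoc, mul_assoc, hEE,
    hRR, hPQX, hQE, hPRE, smul_smul, smul_add, smul_sub]
  module

/-- If `Q₁, Q₂, Q₃` are orthogonal projections in `Mₙ(ℂ)` (`n ≥ 3`) summing to `I`,
then `ℂQ₁ + (Q₁+Q₂) Mₙ(ℂ) (Q₂+Q₃)` is idempotent compressible, and so is its
unitization. -/
theorem example_3_1_1 {n : ℕ} (hn : 3 ≤ n) (Q₁ Q₂ Q₃ : Mat n)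
    (hQ₁ : Q₁ * Q₁ = Q₁) (hQ₁' : Q₁ᴴ = Q₁)
    (hQ₂ : Q₂ * Q₂ = Q₂) (hQ₂' : Q₂ᴴ = Q₂)
    (hQ₃ : Q₃ * Q₃ = Q₃) (hQ₃' : Q₃ᴴ = Q₃)
    (hsum : Q₁ + Q₂ + Q₃ = 1) :
    IdempotentCompressible
      {M : Mat n | ∃ (α : ℂ) (T : Mat n), M = α • Q₁ + (Q₁ + Q₂) * T * (Q₂ + Q₃)} ∧
    IdempotentCompressible
      (unitization {M : Mat n | ∃ (α : ℂ) (T : Mat n), M = α • Q₁ + (Q₁ + Q₂) * T * (Q₂ + Q₃)}) := by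
  have hR : (Q₂ + Q₃) * (Q₂ + Q₃) = Q₂ + Q₃ := by
    rw [show Q₂ + Q₃ = 1 - Q₁ by rw [← hsum]; abel]
    exact IsIdempotentElem.one_sub hQ₁
  have hQ₁₃ : Q₁ * Q₃ + Q₃ * Q₁ = 0 := by
    have h : (Q₁ + Q₃) * (Q₁ + Q₃) = Q₁ + Q₃ := by
      rw [show Q₁ + Q₃ = 1 - Q₂ by rw [← hsum]; abel]
      exact IsIdempotentElem.one_sub hQ₂
    exact (IsIdempotentElem.add_iff hQ₁ hQ₃).mp h
  have hQ₃₁ : Q₃ * Q₁ = 0 := by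
    have : IsAddTorsionFree (Mat n) := IsAddTorsionFree.of_module_rat _
    exact IsIdempotentElem.mul_eq_zero_of_anticommute hQ₃ ((add_comm _ _).trans hQ₁₃)
  have hPQ : (Q₁ + Q₂) * Q₁ = Q₁ := by
    rw [show Q₁ + Q₂ = 1 - Q₃ by rw [← hsum]; abel, sub_mul, hQ₃₁, one_mul, sub_zero]
  have hA := idempotentCompressible_smul_add_mul hR hPQ (by rw [← hsum, add_assoc])
  refine ⟨hA, hA.unitization ?_ ?_⟩
  · rintro _ ⟨α, T, rfl⟩ _ ⟨β, S, rfl⟩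
    exact ⟨α + β, T + S, by
      rw [mul_add (Q₁ + Q₂) T S, add_mul _ _ (Q₂ + Q₃), add_smul, add_add_add_comm]⟩
  · rintro c _ ⟨α, T, rfl⟩
    exact ⟨c * α, c • T, by rw [mul_smul_comm, smul_mul_assoc, smul_add, smul_smul]⟩
end

section
/- Let n ≥ 3 be an integer, let Q₁ and Q₂ be mutually orthogonal rank-one orthogonal projections in M_n(ℂ), let Q₃ := I − Q₁ − Q₂, and let 𝒜 := ℂ(Q₁+Q₂) + Q₁·M_n(ℂ)·Q₂ + (Q₁+Q₂)·M_n(ℂ)·Q₃. If E is an idempotent in M_n(ℂ) such that EQ₂E belongs to E𝒜E = {EAE : A ∈ 𝒜}, then E𝒜E is closed under multiplication (i.e., E𝒜E is an algebra). -/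
open Matrix

namespace Matrix

variable {K m n : Type*} [Field K] [Fintype n]

/-- A square matrix over a field has a generalized inverse. -/
theorem exists_mul_mul_eq_self [DecidableEq n] (N : Matrix n n K) :
    ∃ G : Matrix n n K, N * G * N = N := by
  set f := Matrix.toLin' N with hf
  obtain ⟨g, hg⟩ := f.rangeRestrict.exists_rightInverse_of_surjective f.range_rangeRestrict
  obtain ⟨h, hh⟩ := LinearMap.exists_extend g
  refine ⟨LinearMap.toMatrix' h, Matrix.toLin'.injective ?_⟩
  rw [Matrix.toLin'_mul, Matrix.toLin'_mul, Matrix.toLin'_toMatrix', ← hf]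
  ext1 i
  ext1
  have h1 : h (f (Pi.single i 1)) = g (f.rangeRestrict (Pi.single i 1)) :=
    LinearMap.congr_fun hh (f.rangeRestrict (Pi.single i 1))
  have h2 := congrArg Subtype.val
    (LinearMap.congr_fun hg (f.rangeRestrict (Pi.single i 1)))
  simpa [h1] using h2

theorem exists_eq_vecMulVec_of_rank_eq_one [DecidableEq n] {P : Matrix m n K}
    (hP : P.rank = 1) : ∃ a b, P = vecMulVec a b := by
  obtain ⟨v, -, hv⟩ := finrank_eq_one_iff'.1 hP
  choose c hc using fun j => hv ⟨P *ᵥ Pi.single j 1, Pi.single j 1, rfl⟩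
  refine ⟨v, c, ?_⟩
  ext i j
  have := congrFun (congrArg Subtype.val (hc j)) i
  simp only [mulVec_single_one, SetLike.val_smul, Pi.smul_apply, smul_eq_mul, col_apply] at this
  rw [vecMulVec_apply, mul_comm, this]

theorem exists_mul_mul_eq_smul_of_rank_eq_one [DecidableEq n] {P : Matrix n n K}
    (hP : P.rank = 1) (M : Matrix n n K) : ∃ c : K, P * M * P = c • P := by
  obtain ⟨a, b, rfl⟩ := exists_eq_vecMulVec_of_rank_eq_one hP
  exact ⟨b ᵥ* M ⬝ᵥ a, by rw [vecMulVec_mul, vecMulVec_mul_vecMulVec, vecMulVec_smul]⟩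

/-- For an idempotent `E` and a rank-one `P`, either `E` maps the range of `P` into itself, or the
rows of `P * E` are combinations of those of `(1 - P) * E`. -/
theorem one_sub_mul_mul_eq_zero_or_exists_mul_eq [DecidableEq n] {P E : Matrix n n K}
    (hP : P.rank = 1) (hE : E * E = E) :
    (1 - P) * E * P = 0 ∨ ∃ R : Matrix n n K, R * ((1 - P) * E) = P * E := by
  obtain ⟨G, hG⟩ := exists_mul_mul_eq_self ((1 - P) * E)
  by_cases h : P * E * (1 - G * ((1 - P) * E)) = 0
  · refine .inr ⟨P * E * G, ?_⟩
    rw [mul_sub, mul_one, sub_eq_zero] at h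
    rw [mul_assoc _ G, ← h]
  left
  set L := 1 - G * ((1 - P) * E) with hL
  have hker : (1 - P) * E * L = 0 := by
    rw [hL, mul_sub, mul_one, ← mul_assoc, hG, sub_self]
  have hfix : E * L = P * E * L := by
    rw [← sub_eq_zero, ← hker]; noncomm_ring
  have hzero : (1 - P) * E * (P * E * L) = 0 := by
    rw [← hfix, ← mul_assoc, mul_assoc _ E E, hE, hker]
  obtain ⟨a, b, hab⟩ := exists_eq_vecMulVec_of_rank_eq_one hP
  rw [mul_assoc, hab, vecMulVec_mul, vecMulVec_eq_zero.not, not_or] at h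
  rw [mul_assoc P, hab, vecMulVec_mul, mul_vecMulVec, vecMulVec_eq_zero, or_iff_left h.2,
    ← hab] at hzero
  conv_lhs => rw [hab, mul_vecMulVec, ← hab]
  rw [hzero, zero_vecMulVec]

end Matrix

/-- Once `E Q₂ E` lies in the compression, that compression equals the compression of
`Q₁ Mₙ(ℂ) + Q₂ Mₙ(ℂ) (1 - Q₁)`. -/
theorem mem_compress_iff {n : ℕ} {Q₁ Q₂ Q₃ E : Mat n}
    (hQ₁ : Q₁ * Q₁ = Q₁) (hQ₁r : Q₁.rank = 1)
    (hQ₂ : Q₂ * Q₂ = Q₂) (hQ₂r : Q₂.rank = 1)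
    (horth : Q₁ * Q₂ = 0 ∧ Q₂ * Q₁ = 0) (hQ₃ : Q₃ = 1 - Q₁ - Q₂)
    (hmem : E * Q₂ * E ∈ compress E {M : Mat n | ∃ (α : ℂ) (S T : Mat n),
      M = α • (Q₁ + Q₂) + Q₁ * S * Q₂ + (Q₁ + Q₂) * T * Q₃}) (M : Mat n) :
    M ∈ compress E {M : Mat n | ∃ (α : ℂ) (S T : Mat n),
      M = α • (Q₁ + Q₂) + Q₁ * S * Q₂ + (Q₁ + Q₂) * T * Q₃} ↔
      ∃ X Y : Mat n, M = E * (Q₁ * X + Q₂ * Y * (1 - Q₁)) * E := by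
  obtain ⟨h12, h21⟩ := horth
  have h31 : Q₃ * Q₁ = 0 := by simp [hQ₃, sub_mul, hQ₁, h21]
  constructor
  · rintro ⟨_, ⟨α, S, T, rfl⟩, rfl⟩
    refine ⟨α • Q₁ + S * Q₂ + T * Q₃, α • Q₂ + T * Q₃, ?_⟩
    refine congrArg (E * · * E) ?_
    simp only [mul_add, add_mul, mul_sub, mul_one, mul_smul_comm, smul_mul_assoc, hQ₁, hQ₂, h21,
      mul_assoc, h31, smul_add, mul_zero, smul_zero]
    abel
  · rintro ⟨X, Y, rfl⟩
    obtain ⟨_, ⟨α, S, T, rfl⟩, h⟩ := hmem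
    obtain ⟨a, ha⟩ := exists_mul_mul_eq_smul_of_rank_eq_one hQ₁r X
    obtain ⟨b, hb⟩ := exists_mul_mul_eq_smul_of_rank_eq_one hQ₂r Y
    refine ⟨_, ⟨a + (b - a) * α, (b - a) • S + X, (b - a) • T + Q₁ * X + Q₂ * Y, rfl⟩, ?_⟩
    have key : Q₁ * X + Q₂ * Y * (1 - Q₁) = a • (Q₁ + Q₂) + (b - a) • Q₂ + Q₁ * X * Q₂
        + (Q₁ + Q₂) * (Q₁ * X + Q₂ * Y) * Q₃ := by
      have e : (Q₁ + Q₂) * (Q₁ * X + Q₂ * Y) = Q₁ * X + Q₂ * Y := by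
        simp only [mul_add, add_mul, ← mul_assoc, hQ₁, hQ₂, h12, h21, zero_mul]
        abel
      rw [e, hQ₃]
      simp only [mul_sub, add_mul, mul_one, ha, hb, sub_smul, smul_add]
      abel
    have h' : E * ((b - a) • Q₂) * E = E * ((b - a) •
        (α • (Q₁ + Q₂) + Q₁ * S * Q₂ + (Q₁ + Q₂) * T * Q₃)) * E := by
      simp only [mul_smul_comm, smul_mul_assoc]
      exact congrArg _ h.symm
    rw [key]
    calc _ = E * (a • (Q₁ + Q₂)) * E + E * ((b - a) •
        (α • (Q₁ + Q₂) + Q₁ * S * Q₂ + (Q₁ + Q₂) * T * Q₃)) * E + E * (Q₁ * X * Q₂) * E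
        + E * ((Q₁ + Q₂) * (Q₁ * X + Q₂ * Y) * Q₃) * E := by
          simp only [mul_add, add_mul, smul_add, add_smul, mul_smul_comm, smul_mul_assoc,
            mul_smul, mul_assoc]
          abel
      _ = _ := by
          rw [← h']
          simp only [mul_add, add_mul]

/-- Lemma 3.1.4: with `𝒜 = ℂ(Q₁+Q₂) + Q₁ Mₙ(ℂ) Q₂ + (Q₁+Q₂) Mₙ(ℂ) Q₃`, if `E` is an
idempotent such that `E Q₂ E ∈ E 𝒜 E`, then `E 𝒜 E` is an algebra. -/
theorem lemma_3_1_4 {n : ℕ} (hn : 3 ≤ n) (Q₁ Q₂ Q₃ : Mat n)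
    (hQ₁ : Q₁ * Q₁ = Q₁) (hQ₁' : Q₁ᴴ = Q₁) (hQ₁r : Q₁.rank = 1)
    (hQ₂ : Q₂ * Q₂ = Q₂) (hQ₂' : Q₂ᴴ = Q₂) (hQ₂r : Q₂.rank = 1)
    (horth : Q₁ * Q₂ = 0 ∧ Q₂ * Q₁ = 0)
    (hQ₃ : Q₃ = 1 - Q₁ - Q₂)
    (E : Mat n) (hE : E * E = E)
    (hmem : E * Q₂ * E ∈ compress E {M : Mat n | ∃ (α : ℂ) (S T : Mat n), M = α • (Q₁ + Q₂) + Q₁ * S * Q₂ + (Q₁ + Q₂) * T * Q₃}) :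
    MulClosed (compress E {M : Mat n | ∃ (α : ℂ) (S T : Mat n), M = α • (Q₁ + Q₂) + Q₁ * S * Q₂ + (Q₁ + Q₂) * T * Q₃}) := by
  have hiff := mem_compress_iff hQ₁ hQ₁r hQ₂ hQ₂r horth hQ₃ hmem
  intro x hx y hy
  obtain ⟨X, Y, rfl⟩ := (hiff x).1 hx
  obtain ⟨X', Y', rfl⟩ := (hiff y).1 hy
  rw [hiff]
  have hprod : E * (Q₁ * X + Q₂ * Y * (1 - Q₁)) * E * (E * (Q₁ * X' + Q₂ * Y' * (1 - Q₁)) * E)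
      = E * (Q₁ * (X * E * (Q₁ * X' + Q₂ * Y' * (1 - Q₁)))
        + Q₂ * (Y * (1 - Q₁) * E * Q₂ * Y') * (1 - Q₁)) * E
        + E * Q₂ * Y * ((1 - Q₁) * E * Q₁) * X' * E := by
    calc _ = E * (Q₁ * X + Q₂ * Y * (1 - Q₁)) * (E * E) *
          (Q₁ * X' + Q₂ * Y' * (1 - Q₁)) * E := by noncomm_ring
      _ = _ := by rw [hE]; noncomm_ring
  rcases one_sub_mul_mul_eq_zero_or_exists_mul_eq hQ₁r hE with h | ⟨R, hR⟩
  · exact ⟨_, _, by rw [hprod, h, mul_zero, zero_mul, zero_mul, add_zero]⟩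
  · refine ⟨X * E * (Q₁ * X' + Q₂ * Y' * (1 - Q₁)),
      Y * (1 - Q₁) * E * Q₂ * Y' + Y * (1 - Q₁) * E * Q₁ * X' * (R + 1), ?_⟩
    have hX : X' * E = X' * (R + 1) * ((1 - Q₁) * E) := by
      rw [mul_assoc, add_mul, hR]; noncomm_ring
    rw [hprod, mul_assoc _ X' E, hX]
    noncomm_ring
end

section
/- Let Q₁, Q₂, Q₃ be rank-one orthogonal projections in M₃(ℂ) with Q₁ + Q₂ + Q₃ = I. Then the subalgebra 𝒜 := ℂQ₁ + ℂQ₂ + (Q₂+Q₃)·M₃(ℂ)·Q₃ = {αQ₁ + βQ₂ + (Q₂+Q₃)TQ₃ : α, β ∈ ℂ, T ∈ M₃(ℂ)} is idempotent compressible. -/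
open Matrix

/-- The algebra of matrices in `M₃(ℂ)` that are block diagonal with an arbitrary `1 × 1` block
followed by an upper triangular `2 × 2` block. -/
def scalarSumUpperTriangular : Set (Mat 3) :=
  {M | M 0 1 = 0 ∧ M 0 2 = 0 ∧ M 1 0 = 0 ∧ M 2 0 = 0 ∧ M 2 1 = 0}

theorem mul_mem_scalarSumUpperTriangular {X Y : Mat 3} (hX : X ∈ scalarSumUpperTriangular)
    (hY : Y ∈ scalarSumUpperTriangular) : X * Y ∈ scalarSumUpperTriangular := by
  obtain ⟨h1, h2, h3, h4, h5⟩ := hX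
  obtain ⟨k1, k2, k3, k4, k5⟩ := hY
  simp [scalarSumUpperTriangular, Matrix.mul_apply, Fin.sum_univ_three, *]

theorem Matrix.exists_eq_vecMulVec_of_rank_le_one {m n K : Type*} [Fintype n]
    [DecidableEq n] [Field K] {A : Matrix m n K} (h : A.rank ≤ 1) :
    ∃ (f : m → K) (g : n → K), A = vecMulVec f g := by
  obtain ⟨v, hv⟩ := finrank_le_one_iff.mp h
  choose c hc using hv
  refine ⟨v, fun j => c ⟨A.mulVecLin (Pi.single j 1), LinearMap.mem_range_self _ _⟩, ?_⟩
  ext i j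
  have := congrFun (congrArg Subtype.val
    (hc ⟨A.mulVecLin (Pi.single j 1), LinearMap.mem_range_self _ _⟩)) i
  simp only [SetLike.val_smul, Pi.smul_apply, smul_eq_mul, Matrix.mulVecLin_apply,
    Matrix.mulVec_single_one, Matrix.col_apply] at this
  simp only [vecMulVec_apply, mul_comm, ← this, Matrix.mulVecLin_apply,
    Matrix.mulVec_single_one]

/-- For `X`, `Y` in the algebra, the rank-one matrix `(X f) (g Y)` lies in the algebra up to
a term of the form `f aᵀ + b gᵀ`. -/
theorem exists_vecMulVec_sub_mem_scalarSumUpperTriangular {X Y : Mat 3}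
    (hX : X ∈ scalarSumUpperTriangular) (hY : Y ∈ scalarSumUpperTriangular)
    (f g : Fin 3 → ℂ) :
    ∃ a b : Fin 3 → ℂ, vecMulVec (X *ᵥ f) (g ᵥ* Y) - vecMulVec f a - vecMulVec b g
      ∈ scalarSumUpperTriangular := by
  obtain ⟨h1, h2, h3, h4, h5⟩ := hX
  obtain ⟨k1, k2, k3, k4, k5⟩ := hY
  simp only [scalarSumUpperTriangular, Set.mem_ofPred_eq, Matrix.sub_apply, vecMulVec_apply,
    Matrix.mulVec, Matrix.vecMul, dotProduct, Fin.sum_univ_three, h1, h2, h3, h4, h5,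
    k1, k2, k3, k4, k5, mul_zero, zero_mul, add_zero, zero_add]
  by_cases f0 : f 0 = 0
  · by_cases f2 : f 2 = 0
    · refine ⟨![X 1 1 * Y 0 0 * g 0, 0, 0], 0, ?_⟩
      simp [f0, f2]
      ring
    · refine ⟨fun j => X 2 2 * ![g 0 * Y 0 0, g 1 * Y 1 1, 0] j,
        ![0, (X 1 1 * f 1 + X 1 2 * f 2 - f 1 * X 2 2) * Y 0 0, 0], ?_⟩
      simp [f0]
      refine ⟨?_, ?_, ?_⟩ <;> ring
  by_cases f2 : f 2 = 0
  · refine ⟨fun j => X 0 0 * ![g 0 * Y 0 0, g 1 * Y 1 1, g 1 * Y 1 2 + g 2 * Y 2 2] j,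
      ![0, (X 1 1 - X 0 0) * f 1 * Y 0 0, 0], ?_⟩
    simp [f2]
    refine ⟨?_, ?_, ?_⟩ <;> ring
  by_cases g0 : g 0 = 0
  · refine ⟨![0, X 0 0 * (g 1 * Y 1 1), X 0 0 * (g 1 * Y 1 2 + g 2 * Y 2 2)],
      ![0, 0, (X 2 2 - X 0 0) * f 2 * Y 1 1], ?_⟩
    simp [g0]
    refine ⟨?_, ?_, ?_⟩ <;> ring
  by_cases g1 : g 1 = 0
  · refine ⟨![0, 0, X 0 0 * (g 1 * Y 1 2 + g 2 * Y 2 2)],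
      ![0, (X 1 1 * f 1 + X 1 2 * f 2) * Y 0 0, X 2 2 * f 2 * Y 0 0], ?_⟩
    simp [g1]
    refine ⟨?_, ?_, ?_⟩ <;> ring
  · let b₂ := (X 2 2 - X 0 0) * f 2 * Y 1 1
    let a₀ := (X 2 2 * f 2 * (g 0 * Y 0 0) - b₂ * g 0) / f 2
    refine ⟨![a₀, X 0 0 * (g 1 * Y 1 1), X 0 0 * (g 1 * Y 1 2 + g 2 * Y 2 2)],
      ![0, ((X 1 1 * f 1 + X 1 2 * f 2) * (g 0 * Y 0 0) - f 1 * a₀) / g 0, b₂], ?_⟩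
    simp [a₀, b₂]
    refine ⟨?_, ?_, ?_, ?_, ?_⟩ <;> field_simp <;> ring

theorem idempotentCompressible_scalarSumUpperTriangular :
    IdempotentCompressible scalarSumUpperTriangular := by
  rintro E hE _ ⟨X, hX, rfl⟩ _ ⟨Y, hY, rfl⟩
  have hprod : E * X * E * (E * Y * E) = E * X * E * Y * E := by
    simp only [← Matrix.mul_assoc]
    rw [Matrix.mul_assoc (E * X) E E, hE]
  simp only [hprod]
  have hE' : E * (1 - E) = 0 := by rw [mul_sub, mul_one, hE, sub_self]
  have hE'' : (1 - E) * E = 0 := by rw [sub_mul, one_mul, hE, sub_self]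
  have hrank := Matrix.rank_add_rank_le_card_of_mul_eq_zero hE'
  rw [Fintype.card_fin] at hrank
  obtain h | h : E.rank ≤ 1 ∨ (1 - E).rank ≤ 1 := by omega
  · obtain ⟨f, g, rfl⟩ := Matrix.exists_eq_vecMulVec_of_rank_le_one h
    obtain ⟨h1, h2, h3, h4, h5⟩ := hY
    refine ⟨(g ⬝ᵥ X *ᵥ f) • Y, ?_, ?_⟩
    · simp [scalarSumUpperTriangular, *]
    · have hX : vecMulVec f g * X * vecMulVec f g = (g ⬝ᵥ X *ᵥ f) • vecMulVec f g := by
        rw [vecMulVec_mul, vecMulVec_mul_vecMulVec, Matrix.dotProduct_mulVec, vecMulVec_smul]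
      simp only [hX, Matrix.mul_smul, Matrix.smul_mul]
  · obtain ⟨f, g, hfg, hf, hg⟩ : ∃ f g : Fin 3 → ℂ, 1 - E = vecMulVec f g ∧
        E *ᵥ f = 0 ∧ g ᵥ* E = 0 := by
      obtain ⟨f, g, hfg⟩ := Matrix.exists_eq_vecMulVec_of_rank_le_one h
      by_cases h0 : 1 - E = 0
      · exact ⟨0, 0, by simp [h0], by simp, by simp⟩
      · rw [hfg] at hE' hE''
        rw [hfg, vecMulVec_eq_zero, not_or] at h0
        rw [mul_vecMulVec, vecMulVec_eq_zero] at hE'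
        rw [vecMulVec_mul, vecMulVec_eq_zero] at hE''
        exact ⟨f, g, hfg, hE'.resolve_right h0.2, hE''.resolve_left h0.1⟩
    obtain ⟨a, b, hab⟩ := exists_vecMulVec_sub_mem_scalarSumUpperTriangular hX hY f g
    refine ⟨X * Y - (vecMulVec (X *ᵥ f) (g ᵥ* Y) - vecMulVec f a - vecMulVec b g), ?_, ?_⟩
    · obtain ⟨h1, h2, h3, h4, h5⟩ := hab
      obtain ⟨k1, k2, k3, k4, k5⟩ := mul_mem_scalarSumUpperTriangular hX hY
      refine ⟨?_, ?_, ?_, ?_, ?_⟩ <;> rw [Matrix.sub_apply] <;> simp only [*, sub_zero]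
    · have hEfg : E * X * E * Y * E = E * (X * Y - X * (1 - E) * Y) * E := by noncomm_ring
      rw [hEfg, hfg, mul_vecMulVec, vecMulVec_mul]
      simp only [mul_sub, sub_mul, mul_vecMulVec, vecMulVec_mul, hf, hg, zero_vecMulVec,
        vecMulVec_zero, sub_zero]

theorem IdempotentCompressible.image_conj {n : ℕ} {A : Set (Mat n)}
    (hA : IdempotentCompressible A) {V W : Mat n} (hWV : W * V = 1) :
    IdempotentCompressible ((fun M => V * M * W) '' A) := by
  have hVW : V * W = 1 := mul_eq_one_comm.mp hWV
  have cancel (M : Mat n) : V * (W * M) = M := by rw [← Matrix.mul_assoc, hVW, one_mul]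
  have cancel' (M : Mat n) : W * (V * M) = M := by rw [← Matrix.mul_assoc, hWV, one_mul]
  rintro E hE _ ⟨_, ⟨X, hX, rfl⟩, rfl⟩ _ ⟨_, ⟨Y, hY, rfl⟩, rfl⟩
  have hE' : W * E * V * (W * E * V) = W * E * V := by
    simp only [Matrix.mul_assoc, cancel]
    rw [← Matrix.mul_assoc E E, hE]
  obtain ⟨Z, hZ, h⟩ := hA _ hE' _ ⟨X, hX, rfl⟩ _ ⟨Y, hY, rfl⟩
  refine ⟨_, ⟨Z, hZ, rfl⟩, ?_⟩
  have := congrArg (fun M => V * M * W) h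
  simpa only [Matrix.mul_assoc, cancel, cancel', hVW, mul_one] using this

theorem mem_scalarSumUpperTriangular_iff {M : Mat 3} :
    M ∈ scalarSumUpperTriangular ↔ ∃ (α β : ℂ) (T : Mat 3),
      M = α • Matrix.single 0 0 1 + β • Matrix.single 1 1 1
        + (Matrix.single 1 1 1 + Matrix.single 2 2 1) * T * Matrix.single 2 2 1 := by
  constructor
  · rintro ⟨h1, h2, h3, h4, h5⟩
    refine ⟨M 0 0, M 1 1, M, ?_⟩
    ext i j
    fin_cases i <;> fin_cases j <;>
      simp [Matrix.mul_apply, Matrix.single_apply, *]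
  · rintro ⟨α, β, T, rfl⟩
    simp [scalarSumUpperTriangular, Matrix.mul_apply, Matrix.single_apply]

/-- Example 3.2.2: if `Q₁, Q₂, Q₃` are rank-one orthogonal projections in `M₃(ℂ)`
summing to `I`, then `ℂQ₁ + ℂQ₂ + (Q₂+Q₃) M₃(ℂ) Q₃` is idempotent compressible. -/
theorem example_3_2_2 (Q₁ Q₂ Q₃ : Mat 3)
    (hQ₁ : Q₁ * Q₁ = Q₁) (hQ₁' : Q₁ᴴ = Q₁) (hQ₁r : Q₁.rank = 1)
    (hQ₂ : Q₂ * Q₂ = Q₂) (hQ₂' : Q₂ᴴ = Q₂) (hQ₂r : Q₂.rank = 1)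
    (hQ₃ : Q₃ * Q₃ = Q₃) (hQ₃' : Q₃ᴴ = Q₃) (hQ₃r : Q₃.rank = 1)
    (hsum : Q₁ + Q₂ + Q₃ = 1) :
    IdempotentCompressible
      {M : Mat 3 | ∃ (α β : ℂ) (T : Mat 3), M = α • Q₁ + β • Q₂ + (Q₂ + Q₃) * T * Q₃} := by
  obtain ⟨v₁, w₁, h₁⟩ := Matrix.exists_eq_vecMulVec_of_rank_le_one hQ₁r.le
  obtain ⟨v₂, w₂, h₂⟩ := Matrix.exists_eq_vecMulVec_of_rank_le_one hQ₂r.le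
  obtain ⟨v₃, w₃, h₃⟩ := Matrix.exists_eq_vecMulVec_of_rank_le_one hQ₃r.le
  let V : Mat 3 := (of ![v₁, v₂, v₃])ᵀ
  let W : Mat 3 := of ![w₁, w₂, w₃]
  have e₁ : Q₁ = V * Matrix.single 0 0 1 * W := by
    ext i j
    simp [V, W, h₁, Matrix.mul_apply, Fin.sum_univ_three, Matrix.single_apply, vecMulVec_apply]
  have e₂ : Q₂ = V * Matrix.single 1 1 1 * W := by
    ext i j
    simp [V, W, h₂, Matrix.mul_apply, Fin.sum_univ_three, Matrix.single_apply, vecMulVec_apply]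
  have e₃ : Q₃ = V * Matrix.single 2 2 1 * W := by
    ext i j
    simp [V, W, h₃, Matrix.mul_apply, Fin.sum_univ_three, Matrix.single_apply, vecMulVec_apply]
  have hVW : V * W = 1 := by
    rw [← hsum]
    ext i j
    simp [V, W, h₁, h₂, h₃, Matrix.mul_apply, Fin.sum_univ_three, vecMulVec_apply]
  have hWV : W * V = 1 := mul_eq_one_comm.mp hVW
  have cancel (M : Mat 3) : W * (V * M) = M := by rw [← Matrix.mul_assoc, hWV, one_mul]
  convert idempotentCompressible_scalarSumUpperTriangular.image_conj hWV using 1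
  ext M
  simp only [Set.mem_ofPred_eq, Set.mem_image, mem_scalarSumUpperTriangular_iff]
  constructor
  · rintro ⟨α, β, T, rfl⟩
    refine ⟨_, ⟨α, β, W * T * V, rfl⟩, ?_⟩
    simp only [e₁, e₂, e₃, Matrix.mul_assoc, mul_add, add_mul, Matrix.mul_smul,
      Matrix.smul_mul]
  · rintro ⟨_, ⟨α, β, T, rfl⟩, rfl⟩
    refine ⟨α, β, V * T * W, ?_⟩
    simp only [e₁, e₂, e₃, Matrix.mul_assoc, mul_add, add_mul, Matrix.mul_smul,
      Matrix.smul_mul, cancel]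
end

section
/- Let 𝒜 be a subalgebra of M₃(ℂ) that is similar to ℬ := { [[α, x, 0], [0, α, 0], [0, 0, β]] : α, β, x ∈ ℂ } (i.e., 𝒜 = S⁻¹ℬS for some invertible S ∈ M₃(ℂ)). Then there exist constants s, t ∈ ℂ and a unitary U ∈ M₃(ℂ) such that U*𝒜U = ℬ_{st} := { [[α, s(α−β), x], [0, β, t(α−β)], [0, 0, α]] : α, β, x ∈ ℂ }. -/
open Matrix

/-- The algebra `ℬ` of Section 5. -/
def algB : Set (Mat 3) := {M : Mat 3 | ∃ α β x : ℂ, M = !![α, x, 0; 0, α, 0; 0, 0, β]}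

/-- The algebra `ℬₛₜ` of Lemma 5.2.1. -/
def algBst (s t : ℂ) : Set (Mat 3) :=
  {M : Mat 3 | ∃ α β x : ℂ, M = !![α, s * (α - β), x; 0, β, t * (α - β); 0, 0, α]}

/-- **QR decomposition**: multiplying a matrix by a suitable unitary makes it upper triangular. -/
theorem exists_unitary_star_mul_blockTriangular {n : ℕ} (Q : Mat n) :
    ∃ U ∈ Matrix.unitaryGroup (Fin n) ℂ, (star U * Q).BlockTriangular id := by
  let f : Fin n → EuclideanSpace ℂ (Fin n) := fun j => WithLp.toLp 2 (fun i => Q i j)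
  have h : Module.finrank ℂ (EuclideanSpace ℂ (Fin n)) = Fintype.card (Fin n) := by simp
  let b := InnerProductSpace.gramSchmidtOrthonormalBasis h f
  refine ⟨(EuclideanSpace.basisFun (Fin n) ℂ).toBasis.toMatrix b,
    OrthonormalBasis.toMatrix_orthonormalBasis_mem_unitary _ _, fun i j hij => ?_⟩
  have hb : inner ℂ (b i) (f j) = 0 :=
    InnerProductSpace.gramSchmidtOrthonormalBasis_inv_triangular h f hij
  simpa [f, Matrix.mul_apply, Matrix.star_apply, Module.Basis.toMatrix_apply, PiLp.inner_apply,
    mul_comm] using hb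

/-- Conjugation by an invertible upper triangular matrix carries `ℬ₀₀` into `ℬₛₜ`, where
`s` and `t` are read off from the triangular matrix. -/
theorem algBst_mul_upperTriangular {a b c d e f : ℂ} (hd : d ≠ 0) (hf : f ≠ 0) {α β x y : ℂ}
    (hy : y * f = a * x + b / d * (α - β) * e) :
    !![α, -(b / d) * (α - β), y; 0, β, e / f * (α - β); 0, 0, α] * !![a, b, c; 0, d, e; 0, 0, f] =
      !![a, b, c; 0, d, e; 0, 0, f] * !![α, 0, x; 0, β, 0; 0, 0, α] := by
  ext i j
  fin_cases i <;> fin_cases j <;> simp [Matrix.mul_apply, Fin.sum_univ_three]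
  · ring
  · field_simp
    ring
  · linear_combination hy
  · ring
  · field_simp
    ring
  · ring

/-- Lemma 5.2.1: every subalgebra of `M₃(ℂ)` similar to `ℬ` is unitarily equivalent
to some `ℬₛₜ`. -/
theorem lemma_5_2_1 (A : Set (Mat 3)) (S : Mat 3) (hS : IsUnit S)
    (hA : A = (fun M => S⁻¹ * M * S) '' algB) :
    ∃ (s t : ℂ) (U : Mat 3), U ∈ Matrix.unitaryGroup (Fin 3) ℂ ∧
      (fun M => star U * M * U) '' A = algBst s t := by
  have hSdet : IsUnit S.det := (Matrix.isUnit_iff_isUnit_det S).1 hS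
  let P : Mat 3 := !![1, 0, 0; 0, 0, 1; 0, 1, 0]
  have hPP : P * P = 1 := by
    ext i j
    fin_cases i <;> fin_cases j <;> simp [P, Matrix.mul_apply, Fin.sum_univ_three]
  have hMP (α β x : ℂ) :
      !![α, x, 0; 0, α, 0; 0, 0, β] * P = P * !![α, 0, x; 0, β, 0; 0, 0, α] := by
    ext i j
    fin_cases i <;> fin_cases j <;> simp [P, Matrix.mul_apply, Fin.sum_univ_three]
  obtain ⟨U, hU, hR⟩ := exists_unitary_star_mul_blockTriangular (S⁻¹ * P)
  have hUU : U * star U = 1 := (Unitary.mem_iff.1 hU).2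
  have hUU' : star U * U = 1 := (Unitary.mem_iff.1 hU).1
  have hRunit : IsUnit (star U * (S⁻¹ * P)) :=
    (IsUnit.of_mul_eq_one _ hUU').mul
      (((Matrix.isUnit_nonsing_inv_iff).2 hS).mul (IsUnit.of_mul_eq_one _ hPP))
  obtain ⟨a, b, c, d, e, f, hRe⟩ : ∃ a b c d e f : ℂ,
      star U * (S⁻¹ * P) = !![a, b, c; 0, d, e; 0, 0, f] := by
    have hη := Matrix.eta_fin_three (star U * (S⁻¹ * P))
    rw [@hR 1 0 (by decide), @hR 2 0 (by decide), @hR 2 1 (by decide)] at hη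
    exact ⟨_, _, _, _, _, _, hη⟩
  have hdet := (Matrix.isUnit_iff_isUnit_det _).1 hRunit
  rw [hRe, Matrix.det_fin_three] at hdet
  have hadf : a * d * f ≠ 0 := by simpa using hdet.ne_zero
  have hf : f ≠ 0 := right_ne_zero_of_mul hadf
  have ha : a ≠ 0 := left_ne_zero_of_mul (left_ne_zero_of_mul hadf)
  have hd : d ≠ 0 := right_ne_zero_of_mul (left_ne_zero_of_mul hadf)
  have key {α β x y : ℂ} (hy : y * f = a * x + b / d * (α - β) * e) :
      star U * (S⁻¹ * !![α, x, 0; 0, α, 0; 0, 0, β] * S) * U =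
        !![α, -(b / d) * (α - β), y; 0, β, e / f * (α - β); 0, 0, α] := by
    apply hRunit.mul_right_cancel
    have hSS : S * S⁻¹ = 1 := Matrix.mul_nonsing_inv S hSdet
    calc star U * (S⁻¹ * !![α, x, 0; 0, α, 0; 0, 0, β] * S) * U * (star U * (S⁻¹ * P))
        = star U * S⁻¹ * !![α, x, 0; 0, α, 0; 0, 0, β] * (S * (U * star U) * S⁻¹) * P := by
          simp only [Matrix.mul_assoc]
      _ = star U * S⁻¹ * (!![α, x, 0; 0, α, 0; 0, 0, β] * P) := by
          rw [hUU, Matrix.mul_one, hSS, Matrix.mul_one, Matrix.mul_assoc]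
      _ = star U * (S⁻¹ * P) * !![α, 0, x; 0, β, 0; 0, 0, α] := by
          rw [hMP]
          simp only [Matrix.mul_assoc]
      _ = _ := by rw [hRe, algBst_mul_upperTriangular hd hf hy]
  refine ⟨-(b / d), e / f, U, hU, ?_⟩
  subst hA
  ext N
  constructor
  · rintro ⟨_, ⟨_, ⟨α, β, x, rfl⟩, rfl⟩, rfl⟩
    exact ⟨α, β, (a * x + b / d * (α - β) * e) / f, key (div_mul_cancel₀ _ hf)⟩
  · rintro ⟨α, β, y, rfl⟩
    refine ⟨_, ⟨_, ⟨α, β, (y * f - b / d * (α - β) * e) / a, rfl⟩, rfl⟩, key ?_⟩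
    rw [mul_div_cancel₀ _ ha]
    ring
end

section
/- For all complex constants s and t, the subalgebra ℬ_{st} := { [[α, s(α−β), x], [0, β, t(α−β)], [0, 0, α]] : α, β, x ∈ ℂ } of M₃(ℂ) is not projection compressible. Consequently, no subalgebra of M₃(ℂ) similar to ℬ := { [[α, x, 0], [0, α, 0], [0, 0, β]] : α, β, x ∈ ℂ } is projection compressible. -/
open Matrix

/-- Finitely many nonzero vectors admit a common vector pairing nontrivially with all of them. -/
theorem exists_forall_dotProduct_ne_zero {n : ℕ} {ι : Type*} [Finite ι] (a : ι → Fin n → ℂ)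
    (ha : ∀ i, a i ≠ 0) : ∃ w : Fin n → ℂ, ∀ i, a i ⬝ᵥ w ≠ 0 := by
  refine Module.Dual.exists_forall_ne_zero_of_forall_exists
    (fun i => dotProductBilin ℂ ℂ (a i)) fun i => ?_
  by_contra! h
  exact ha i (dotProduct_eq_zero _ h)

/-- The orthogonal projection onto the complement of the line spanned by `w`. -/
noncomputable def projCompl {n : ℕ} (w : Fin n → ℂ) : Mat n :=
  1 - (star w ⬝ᵥ w)⁻¹ • vecMulVec w (star w)

open scoped ComplexOrder in
theorem projCompl_mul_self {n : ℕ} {w : Fin n → ℂ} (hw : w ≠ 0) :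
    projCompl w * projCompl w = projCompl w := by
  have h : star w ⬝ᵥ w ≠ 0 := mt dotProduct_star_self_eq_zero.1 hw
  simp [projCompl, sub_mul, mul_sub, vecMulVec_mul_vecMulVec, smul_smul, h]

theorem conjTranspose_projCompl {n : ℕ} (w : Fin n → ℂ) : (projCompl w)ᴴ = projCompl w := by
  rw [projCompl, conjTranspose_sub, conjTranspose_one, conjTranspose_smul, star_inv₀,
    ← star_dotProduct, conjTranspose_vecMulVec, star_star]

theorem dotProduct_projCompl_mulVec {n : ℕ} (w l r : Fin n → ℂ) :
    l ⬝ᵥ projCompl w *ᵥ r = l ⬝ᵥ r - (star w ⬝ᵥ w)⁻¹ * (l ⬝ᵥ w) * (star w ⬝ᵥ r) := by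
  simp [projCompl, sub_mulVec, smul_mulVec, vecMulVec_mulVec]
  ring

/-- In a two-dimensional algebra with invertible Gram data `p, q, r, s`, the product of the two
rank-one generators is not a combination of the identity and the generators. -/
theorem gram_relations_false {p q r s x y z : ℂ} (hq : q ≠ 0) (hr : r ≠ 0)
    (hdet : p * s - q * r ≠ 0)
    (hpr : q * (p * r) = x * p + y * (p * p) + z * (q * r))
    (hrr : q * (r * r) = x * r + y * (r * p) + z * (s * r))
    (hps : q * (p * s) = x * q + y * (p * q) + z * (q * s))
    (hrs : q * (r * s) = x * s + y * (r * q) + z * (s * s)) : False := by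
  have h₁ : q * r - x - y * p = 0 := by
    refine (mul_eq_zero.1 ?_).resolve_right hdet
    linear_combination s * hpr - q * hrr
  have hz : z = 0 := by
    refine (mul_eq_zero.1 ?_).resolve_right (mul_ne_zero hr hdet)
    linear_combination r * hpr - p * hrr
  have h₂ : q * s - y * q = 0 := by
    refine (mul_eq_zero.1 ?_).resolve_right hdet
    subst hz
    linear_combination s * hps - q * hrs
  have hx : x = 0 := by
    refine (mul_eq_zero.1 ?_).resolve_right hdet
    subst hz
    linear_combination r * hps - p * hrs
  have hy : y = s := mul_right_cancel₀ hq (by linear_combination -h₂)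
  subst hx hy
  exact hdet (by linear_combination -h₁)

open scoped ComplexOrder in
/-- The span of the identity, a rank-one idempotent `u ⊗ f` and a rank-one nilpotent `v ⊗ g`
annihilated by it on both sides is not projection compressible. -/
theorem not_projectionCompressible_of_rankOne {n : ℕ} {A : Set (Mat n)} {u v f g : Fin n → ℂ}
    (hv : v ≠ 0) (hg : g ≠ 0) (hfu : f ⬝ᵥ u = 1) (hfv : f ⬝ᵥ v = 0) (hgu : g ⬝ᵥ u = 0)
    (hgv : g ⬝ᵥ v = 0)
    (hA : ∀ M, M ∈ A ↔ ∃ x y z : ℂ, M = x • 1 + y • vecMulVec u f + z • vecMulVec v g) :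
    ¬ ProjectionCompressible A := by
  intro hPC
  have hf : f ≠ 0 := by rintro rfl; simp at hfu
  have hu : u ≠ 0 := by rintro rfl; simp at hfu
  obtain ⟨w, hw⟩ := exists_forall_dotProduct_ne_zero ![f, g, star u, star v] (by
    simp [Fin.forall_fin_succ, hf, hg, hu, hv])
  obtain ⟨hfw, hgw, huw, hvw⟩ :
      f ⬝ᵥ w ≠ 0 ∧ g ⬝ᵥ w ≠ 0 ∧ star w ⬝ᵥ u ≠ 0 ∧ star w ⬝ᵥ v ≠ 0 := by
    rw [star_dotProduct w u, star_dotProduct w v, star_ne_zero, star_ne_zero]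
    simpa [Fin.forall_fin_succ] using hw
  have hw0 : w ≠ 0 := by rintro rfl; simp at hfw
  have hc : (star w ⬝ᵥ w)⁻¹ ≠ 0 := inv_ne_zero (mt dotProduct_star_self_eq_zero.1 hw0)
  have hP := projCompl_mul_self hw0
  obtain ⟨M, hM, hMeq⟩ := hPC _ hP (conjTranspose_projCompl w)
    _ ⟨vecMulVec u f, (hA _).2 ⟨0, 1, 0, by simp⟩, rfl⟩
    _ ⟨vecMulVec v g, (hA _).2 ⟨0, 0, 1, by simp⟩, rfl⟩
  obtain ⟨x, y, z, rfl⟩ := (hA M).1 hM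
  set P := projCompl w with hPdef
  have key (l r : Fin n → ℂ) :
      (f ⬝ᵥ P *ᵥ v) * ((l ⬝ᵥ P *ᵥ u) * (g ⬝ᵥ P *ᵥ r)) =
        x * (l ⬝ᵥ P *ᵥ r) + y * ((l ⬝ᵥ P *ᵥ u) * (f ⬝ᵥ P *ᵥ r)) +
          z * ((l ⬝ᵥ P *ᵥ v) * (g ⬝ᵥ P *ᵥ r)) := by
    have hPP (t : Fin n → ℂ) : P *ᵥ P *ᵥ t = P *ᵥ t := by rw [mulVec_mulVec, hP]
    have h := congrArg (fun N => l ⬝ᵥ N *ᵥ r) hMeq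
    simp [← mulVec_mulVec, add_mulVec, smul_mulVec, vecMulVec_mulVec, mulVec_add, mulVec_smul,
      hPP] at h
    linear_combination -h
  have hval := dotProduct_projCompl_mulVec w
  rw [← hPdef] at hval
  refine gram_relations_false (p := f ⬝ᵥ P *ᵥ u) (r := g ⬝ᵥ P *ᵥ u) (s := g ⬝ᵥ P *ᵥ v)
    ?_ ?_ ?_ (key f u) (key g u) (key f v) (key g v)
  · rw [hval, hfv, zero_sub]
    exact neg_ne_zero.2 (mul_ne_zero (mul_ne_zero hc hfw) hvw)
  · rw [hval, hgu, zero_sub]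
    exact neg_ne_zero.2 (mul_ne_zero (mul_ne_zero hc hgw) huw)
  · rw [hval, hval, hval, hval, hfu, hfv, hgu, hgv]
    convert neg_ne_zero.2 (mul_ne_zero (mul_ne_zero hc hgw) hvw) using 1
    ring

theorem mem_algBst_iff (s t : ℂ) (M : Mat 3) :
    M ∈ algBst s t ↔ ∃ x y z : ℂ,
      M = x • 1 + y • vecMulVec ![-s, 1, 0] ![0, 1, -t] + z • vecMulVec ![1, 0, 0] ![0, 0, 1] := by
  constructor
  · rintro ⟨α, β, x, rfl⟩
    refine ⟨α, β - α, x - (β - α) * s * t, ?_⟩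
    ext i j
    fin_cases i <;> fin_cases j <;> simp <;> ring
  · rintro ⟨x, y, z, rfl⟩
    refine ⟨x, x + y, y * s * t + z, ?_⟩
    ext i j
    fin_cases i <;> fin_cases j <;> simp <;> ring

theorem mem_algB_iff (M : Mat 3) :
    M ∈ algB ↔ ∃ x y z : ℂ,
      M = x • 1 + y • vecMulVec ![0, 0, 1] ![0, 0, 1] + z • vecMulVec ![1, 0, 0] ![0, 1, 0] := by
  constructor
  · rintro ⟨α, β, x, rfl⟩
    refine ⟨α, β - α, x, ?_⟩
    ext i j
    fin_cases i <;> fin_cases j <;> simp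
  · rintro ⟨x, y, z, rfl⟩
    refine ⟨x, x + y, z, ?_⟩
    ext i j
    fin_cases i <;> fin_cases j <;> simp

/-- Theorem 5.2.2: no `ℬₛₜ` is projection compressible; consequently no algebra
similar to `ℬ` is projection compressible. -/
theorem theorem_5_2_2 :
    (∀ s t : ℂ, ¬ ProjectionCompressible (algBst s t)) ∧
    (∀ (A : Set (Mat 3)) (S : Mat 3), IsUnit S →
      A = (fun M => S⁻¹ * M * S) '' algB → ¬ ProjectionCompressible A) := by
  refine ⟨fun s t => not_projectionCompressible_of_rankOne (by simp) (by simp) (by simp) (by simp)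
    (by simp) (by simp) (mem_algBst_iff s t), ?_⟩
  rintro A S hS rfl
  have hdet := (isUnit_iff_isUnit_det S).1 hS
  have hSS : S * S⁻¹ = 1 := mul_nonsing_inv S hdet
  have hdot (a b : Fin 3 → ℂ) : (a ᵥ* S) ⬝ᵥ (S⁻¹ *ᵥ b) = a ⬝ᵥ b := by
    rw [← dotProduct_mulVec, mulVec_mulVec, hSS, one_mulVec]
  refine not_projectionCompressible_of_rankOne
    (u := S⁻¹ *ᵥ ![0, 0, 1]) (f := ![0, 0, 1] ᵥ* S)
    (v := S⁻¹ *ᵥ ![1, 0, 0]) (g := ![0, 1, 0] ᵥ* S) ?_ ?_ ?_ ?_ ?_ ?_ fun M => ?_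
  · intro h
    simpa [h] using hdot ![1, 0, 0] ![1, 0, 0]
  · intro h
    simpa [h] using hdot ![0, 1, 0] ![0, 1, 0]
  iterate 4 · simp [hdot]
  have hconj (x y z : ℂ) (a b c d : Fin 3 → ℂ) :
      S⁻¹ * (x • 1 + y • vecMulVec a b + z • vecMulVec c d) * S =
        x • 1 + y • vecMulVec (S⁻¹ *ᵥ a) (b ᵥ* S) + z • vecMulVec (S⁻¹ *ᵥ c) (d ᵥ* S) := by
    simp [mul_add, add_mul, mul_vecMulVec, vecMulVec_mul, nonsing_inv_mul S hdet]
  constructor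
  · rintro ⟨N, hN, rfl⟩
    obtain ⟨x, y, z, rfl⟩ := (mem_algB_iff N).1 hN
    exact ⟨x, y, z, hconj ..⟩
  · rintro ⟨x, y, z, rfl⟩
    exact ⟨_, (mem_algB_iff _).2 ⟨x, y, z, rfl⟩, hconj ..⟩
end

section
/- Let 𝒜 be a subalgebra of M₃(ℂ) that is similar to 𝒞 := { [[α, x, y], [0, α, x], [0, 0, α]] : α, x, y ∈ ℂ } (i.e., 𝒜 = S⁻¹𝒞S for some invertible S ∈ M₃(ℂ)). Then there exist a non-zero constant r ∈ ℂ and a unitary U ∈ M₃(ℂ) such that U*𝒜U = 𝒞_r := { [[α, x, y], [0, α, rx], [0, 0, α]] : α, x, y ∈ ℂ }. -/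
open Matrix

/-- The algebra `𝒞` of Section 5. -/
def algC : Set (Mat 3) := {M : Mat 3 | ∃ α x y : ℂ, M = !![α, x, y; 0, α, x; 0, 0, α]}

/-- The algebra `𝒞ᵣ` of Lemma 5.2.3. -/
def algCr (r : ℂ) : Set (Mat 3) :=
  {M : Mat 3 | ∃ α x y : ℂ, M = !![α, x, y; 0, α, r * x; 0, 0, α]}

/-- QR decomposition: every square complex matrix becomes upper triangular after left
multiplication by a suitable unitary matrix. -/
theorem exists_unitary_star_mul_upperTriangular {n : ℕ} (P : Mat n) :
    ∃ U ∈ Matrix.unitaryGroup (Fin n) ℂ, ∀ i j, j < i → (star U * P) i j = 0 := by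
  let f : Fin n → EuclideanSpace ℂ (Fin n) := fun j => WithLp.toLp 2 (fun k => P k j)
  have hcard : Module.finrank ℂ (EuclideanSpace ℂ (Fin n)) = Fintype.card (Fin n) := by simp
  let b := InnerProductSpace.gramSchmidtOrthonormalBasis hcard f
  refine ⟨(EuclideanSpace.basisFun (Fin n) ℂ).toBasis.toMatrix b,
    (EuclideanSpace.basisFun (Fin n) ℂ).toMatrix_orthonormalBasis_mem_unitary b,
    fun i j hij => ?_⟩
  have h : inner ℂ (b i) (f j) = 0 :=
    InnerProductSpace.gramSchmidtOrthonormalBasis_inv_triangular hcard f hij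
  rw [← h, PiLp.inner_apply, Matrix.mul_apply]
  refine Finset.sum_congr rfl fun k _ => ?_
  simp [Matrix.star_apply, Module.Basis.toMatrix_apply, f, mul_comm]

/-- Conjugating `algC` by an invertible upper triangular matrix yields `algCr r` for the
ratio `r` determined by the diagonal entries. -/
theorem image_conj_algC_of_upperTriangular {T T' : Mat 3} {a b c d e f : ℂ}
    (hT : T = !![a, b, c; 0, d, e; 0, 0, f]) (ha : a ≠ 0) (hd : d ≠ 0) (hf : f ≠ 0)
    (hTT' : T * T' = 1) :
    (fun M => T * M * T') '' algC = algCr (d ^ 2 / (a * f)) := by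
  have intertwine : ∀ α x y : ℂ, T * !![α, x, y; 0, α, x; 0, 0, α] * T' =
      !![α, a * x / d, (a * y + b * x - a * x / d * e) / f;
        0, α, d ^ 2 / (a * f) * (a * x / d); 0, 0, α] := by
    intro α x y
    have h : T * !![α, x, y; 0, α, x; 0, 0, α] =
        !![α, a * x / d, (a * y + b * x - a * x / d * e) / f;
          0, α, d ^ 2 / (a * f) * (a * x / d); 0, 0, α] * T := by
      rw [hT]
      ext i j
      fin_cases i <;> fin_cases j <;> simp [Matrix.mul_apply, Fin.sum_univ_three] <;>
        field_simp <;> ring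
    rw [h, Matrix.mul_assoc, hTT', Matrix.mul_one]
  ext M
  constructor
  · rintro ⟨_, ⟨α, x, y, rfl⟩, rfl⟩
    exact ⟨α, _, _, intertwine α x y⟩
  · rintro ⟨α, x, y, rfl⟩
    refine ⟨_, ⟨α, d * x / a, (f * y + x * e - b * (d * x / a)) / a, rfl⟩, ?_⟩
    refine (intertwine _ _ _).trans ?_
    have hx : a * (d * x / a) / d = x := by field_simp
    have hy : (a * ((f * y + x * e - b * (d * x / a)) / a) + b * (d * x / a) - x * e) / f = y := by
      field_simp
      ring
    rw [hx, hy]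

/-- Lemma 5.2.3: every subalgebra of `M₃(ℂ)` similar to `𝒞` is unitarily equivalent
to some `𝒞ᵣ` with `r ≠ 0`. -/
theorem lemma_5_2_3 (A : Set (Mat 3)) (S : Mat 3) (hS : IsUnit S)
    (hA : A = (fun M => S⁻¹ * M * S) '' algC) :
    ∃ (r : ℂ), r ≠ 0 ∧ ∃ U : Mat 3, U ∈ Matrix.unitaryGroup (Fin 3) ℂ ∧
      (fun M => star U * M * U) '' A = algCr r := by
  obtain ⟨U, hU, hT⟩ := exists_unitary_star_mul_upperTriangular S⁻¹
  have hTT' : (star U * S⁻¹) * (S * U) = 1 := by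
    rw [Matrix.mul_assoc, Matrix.nonsing_inv_mul_cancel_left _ _
      ((Matrix.isUnit_iff_isUnit_det S).1 hS)]
    exact Matrix.mem_unitaryGroup_iff'.1 hU
  set T := star U * S⁻¹
  have hdet : T.det ≠ 0 := (Matrix.isUnit_det_of_right_inverse hTT').ne_zero
  rw [Matrix.det_of_isUpperTriangular fun i j hij => hT i j hij, Fin.prod_univ_three] at hdet
  obtain ⟨⟨h0, h1⟩, h2⟩ : (T 0 0 ≠ 0 ∧ T 1 1 ≠ 0) ∧ T 2 2 ≠ 0 := by
    simpa only [mul_ne_zero_iff] using hdet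
  have hform : T = !![T 0 0, T 0 1, T 0 2; 0, T 1 1, T 1 2; 0, 0, T 2 2] := by
    conv_lhs => rw [Matrix.eta_fin_three T]
    rw [hT 1 0 (by decide), hT 2 0 (by decide), hT 2 1 (by decide)]
  refine ⟨T 1 1 ^ 2 / (T 0 0 * T 2 2), by positivity, U, hU, ?_⟩
  rw [← image_conj_algC_of_upperTriangular hform h0 h1 h2 hTT', hA, Set.image_image]
  simp only [T, Matrix.mul_assoc]
end

section
/- For every non-zero complex constant r, the subalgebra 𝒞_r := { [[α, x, y], [0, α, rx], [0, 0, α]] : α, x, y ∈ ℂ } of M₃(ℂ) is not projection compressible. Consequently, no subalgebra of M₃(ℂ) similar to 𝒞 := { [[α, x, y], [0, α, x], [0, 0, α]] : α, x, y ∈ ℂ } is projection compressible. -/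
open Matrix

/-- The projection onto the orthogonal complement of `(1, 1, 1)` shows that `algCr r` is not
projection compressible. -/
theorem not_projectionCompressible_algCr {r : ℂ} (hr : r ≠ 0) :
    ¬ ProjectionCompressible (algCr r) := by
  intro h
  let P : Mat 3 := !![2/3, -1/3, -1/3; -1/3, 2/3, -1/3; -1/3, -1/3, 2/3]
  have hP : P * P = P := by
    ext i j
    fin_cases i <;> fin_cases j <;> simp [P, Matrix.mul_apply, Fin.sum_univ_three] <;> norm_num
  have hPs : Pᴴ = P := by
    ext i j
    fin_cases i <;> fin_cases j <;> simp [P, Matrix.conjTranspose_apply]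
  obtain ⟨_, ⟨α, x, y, rfl⟩, hM⟩ := h P hP hPs
    _ ⟨!![0, 0, 1; 0, 0, 0; 0, 0, 0], ⟨0, 0, 1, by simp⟩, rfl⟩
    _ ⟨!![0, 1, 0; 0, 0, r; 0, 0, 0], ⟨0, 1, 0, by simp⟩, rfl⟩
  have entry (i j : Fin 3) := congrFun (congrFun hM i) j
  have h00 := entry 0 0
  have h01 := entry 0 1
  have h02 := entry 0 2
  have h10 := entry 1 0
  have h11 := entry 1 1
  have h12 := entry 1 2
  have h20 := entry 2 0
  have h21 := entry 2 1
  have h22 := entry 2 2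
  simp [P, Matrix.mul_apply, Fin.sum_univ_three] at h00 h01 h02 h10 h11 h12 h20 h21 h22
  have hα : α = 0 := by linear_combination h11 - h10 - h21 + h20
  have hx : x = 0 := by
    subst hα
    have : r * x = 0 := by grind
    simpa [hr] using this
  subst hα hx
  grind

/-- Every square complex matrix is the product of a unitary and an upper triangular matrix. -/
theorem exists_unitary_mul_isUpperTriangular {n : ℕ} (M : Mat n) :
    ∃ U T : Mat n, Uᴴ * U = 1 ∧ U * Uᴴ = 1 ∧ T.IsUpperTriangular ∧ M = U * T := by
  let f : Fin n → EuclideanSpace ℂ (Fin n) := fun j => WithLp.toLp 2 (Mᵀ j)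
  let b := InnerProductSpace.gramSchmidtOrthonormalBasis (𝕜 := ℂ) (by simp) f
  let e := EuclideanSpace.basisFun (Fin n) ℂ
  have hU := e.toMatrix_orthonormalBasis_mem_unitary b
  refine ⟨e.toBasis.toMatrix b.toBasis, b.toBasis.toMatrix f, hU.1, hU.2,
    InnerProductSpace.gramSchmidtOrthonormalBasis_inv_isUpperTriangular _ f, ?_⟩
  rw [Module.Basis.toMatrix_mul_toMatrix]
  ext i j
  simp [e, f, Module.Basis.toMatrix_apply]

/-- Projection compressibility is preserved by unitary conjugation. -/
theorem ProjectionCompressible.of_unitary_conj {n : ℕ} {A : Set (Mat n)} {U : Mat n}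
    (hU : Uᴴ * U = 1) (hA : ProjectionCompressible ((fun M => U * M * Uᴴ) '' A)) :
    ProjectionCompressible A := by
  have cancel (X : Mat n) : Uᴴ * (U * X) = X := by rw [← mul_assoc, hU, one_mul]
  rintro P hP hPs _ ⟨X, hX, rfl⟩ _ ⟨Y, hY, rfl⟩
  obtain ⟨_, ⟨Z, hZ, rfl⟩, h⟩ := hA (U * P * Uᴴ)
    (by simp only [mul_assoc, cancel]; rw [← mul_assoc P, hP])
    (by simp [hPs, mul_assoc])
    _ ⟨_, ⟨X, hX, rfl⟩, rfl⟩ _ ⟨_, ⟨Y, hY, rfl⟩, rfl⟩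
  refine ⟨Z, hZ, ?_⟩
  have := congrArg (fun W => Uᴴ * W * U) h
  simpa only [mul_assoc, cancel, hU, mul_one] using this

/-- Conjugating `algC` by an invertible upper triangular matrix gives some `algCr r`. -/
theorem exists_algCr_eq_conj_algC {T R : Mat 3} (hT : T.IsUpperTriangular) (hTR : T * R = 1) :
    ∃ r : ℂ, r ≠ 0 ∧ (fun M => T * M * R) '' algC = algCr r := by
  have h10 : T 1 0 = 0 := hT (by decide)
  have h20 : T 2 0 = 0 := hT (by decide)
  have h21 : T 2 1 = 0 := hT (by decide)
  have hdet : T.det ≠ 0 := Matrix.det_ne_zero_of_right_inverse hTR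
  rw [Matrix.det_of_isUpperTriangular hT, Fin.prod_univ_three] at hdet
  have h0 : T 0 0 ≠ 0 := by grind
  have h1 : T 1 1 ≠ 0 := by grind
  have h2 : T 2 2 ≠ 0 := by grind
  refine ⟨T 1 1 ^ 2 / (T 0 0 * T 2 2), by positivity, ?_⟩
  have conj_eq {M M' : Mat 3} (h : T * M = M' * T) : T * M * R = M' := by
    rw [h, mul_assoc, hTR, mul_one]
  have intertwine (α x y : ℂ) :
      T * !![α, x, y; 0, α, x; 0, 0, α] =
        !![α, T 0 0 / T 1 1 * x, (x * T 0 1 + y * T 0 0 - T 0 0 / T 1 1 * x * T 1 2) / T 2 2;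
          0, α, T 1 1 ^ 2 / (T 0 0 * T 2 2) * (T 0 0 / T 1 1 * x); 0, 0, α] * T := by
    ext i j
    fin_cases i <;> fin_cases j <;>
      simp [Matrix.mul_apply, Fin.sum_univ_three, h10, h20, h21] <;> field_simp <;> ring
  ext M
  constructor
  · rintro ⟨_, ⟨α, x, y, rfl⟩, rfl⟩
    exact ⟨α, _, _, conj_eq (intertwine α x y)⟩
  · rintro ⟨α, x, y, rfl⟩
    let x' := T 1 1 / T 0 0 * x
    refine ⟨_, ⟨α, x', (y * T 2 2 - x' * T 0 1 + x * T 1 2) / T 0 0, rfl⟩, ?_⟩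
    refine conj_eq ((intertwine _ _ _).trans ?_)
    congr 1
    have hx : T 0 0 / T 1 1 * x' = x := by simp only [x']; field_simp
    rw [hx]
    congr 5
    field_simp
    ring

/-- Theorem 5.2.4: no `𝒞ᵣ` with `r ≠ 0` is projection compressible; consequently no
algebra similar to `𝒞` is projection compressible. -/
theorem theorem_5_2_4 :
    (∀ r : ℂ, r ≠ 0 → ¬ ProjectionCompressible (algCr r)) ∧
    (∀ (A : Set (Mat 3)) (S : Mat 3), IsUnit S →
      A = (fun M => S⁻¹ * M * S) '' algC → ¬ ProjectionCompressible A) := by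
  refine ⟨fun r hr => not_projectionCompressible_algCr hr, ?_⟩
  rintro A S hS rfl hA
  obtain ⟨U, T, hU, hU', hT, hST⟩ := exists_unitary_mul_isUpperTriangular S⁻¹
  have hdet : IsUnit S.det := (Matrix.isUnit_iff_isUnit_det S).mp hS
  have hSU : T * (S * U) = 1 := by
    calc T * (S * U) = Uᴴ * (U * T) * S * U := by
          rw [← mul_assoc Uᴴ, hU, one_mul, mul_assoc]
      _ = 1 := by rw [← hST, mul_assoc Uᴴ, Matrix.nonsing_inv_mul S hdet, mul_one, hU]
  obtain ⟨r, hr, hC⟩ := exists_algCr_eq_conj_algC hT hSU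
  refine not_projectionCompressible_algCr hr (ProjectionCompressible.of_unitary_conj hU ?_)
  rw [← hC, Set.image_image]
  convert hA using 2
  rw [hST]
  simp only [mul_assoc, hU', mul_one]
end

section
/- Let 𝒜 be a subalgebra of M₃(ℂ) that is similar to the algebra 𝒟 of all diagonal matrices { diag(α, β, γ) : α, β, γ ∈ ℂ } (i.e., 𝒜 = S⁻¹𝒟S for some invertible S ∈ M₃(ℂ)). Then there exist complex constants r, s, t and a unitary U ∈ M₃(ℂ) such that U*𝒜U = 𝒟_{rst} := { [[α, r(α−β), s(α−γ)−rt(γ−β)], [0, β, t(γ−β)], [0, 0, γ]] : α, β, γ ∈ ℂ }. -/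
open Matrix

/-- The algebra `𝒟` of all diagonal matrices in `M₃(ℂ)`. -/
def algD : Set (Mat 3) := {M : Mat 3 | ∃ α β γ : ℂ, M = !![α, 0, 0; 0, β, 0; 0, 0, γ]}

/-- The algebra `𝒟ᵣₛₜ` of Lemma 5.2.5. -/
def algDrst (r s t : ℂ) : Set (Mat 3) :=
  {M : Mat 3 | ∃ α β γ : ℂ,
    M = !![α, r * (α - β), s * (α - γ) - r * t * (γ - β);
           0, β, t * (γ - β); 0, 0, γ]}

/-- **QR decomposition**: every square complex matrix becomes upper triangular after multiplication
on the left by a suitable unitary matrix. -/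
theorem exists_unitary_star_mul_isUpperTriangular {n : ℕ} (B : Mat n) :
    ∃ U ∈ Matrix.unitaryGroup (Fin n) ℂ, (star U * B).IsUpperTriangular := by
  let f : Fin n → EuclideanSpace ℂ (Fin n) := fun j => WithLp.toLp 2 fun i => B i j
  let b := InnerProductSpace.gramSchmidtOrthonormalBasis (𝕜 := ℂ) (by simp) f
  have inner_eq (i : Fin n) (v : EuclideanSpace ℂ (Fin n)) :
      inner ℂ (b i) v = ∑ k, star (b i k) * v k := by
    simp [PiLp.inner_apply, mul_comm]
  refine ⟨Matrix.of fun i j => b j i, ?_, fun i j hij => ?_⟩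
  · rw [Matrix.mem_unitaryGroup_iff']
    ext i j
    have h := orthonormal_iff_ite.mp b.orthonormal i j
    rw [inner_eq] at h
    simpa [Matrix.mul_apply, Matrix.one_apply] using h
  · have h : inner ℂ (b i) (f j) = 0 :=
      InnerProductSpace.gramSchmidtOrthonormalBasis_inv_triangular (by simp) f hij
    rw [inner_eq] at h
    simpa [Matrix.mul_apply, f] using h

/-- The algebra of diagonal matrices, conjugated by an invertible upper triangular matrix. -/
theorem exists_image_conj_algD_eq_algDrst {R : Mat 3} (hR : IsUnit R)
    (hT : R.IsUpperTriangular) :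
    ∃ r s t : ℂ, (fun M => R * M * R⁻¹) '' algD = algDrst r s t := by
  have hdet : IsUnit R.det := (Matrix.isUnit_iff_isUnit_det R).mp hR
  have hdiag : R 0 0 * R 1 1 * R 2 2 ≠ 0 := by
    rw [← Fin.prod_univ_three fun i => R i i, ← Matrix.det_of_isUpperTriangular hT]
    exact hdet.ne_zero
  have h1 : R 1 1 ≠ 0 := right_ne_zero_of_mul (left_ne_zero_of_mul hdiag)
  have h2 : R 2 2 ≠ 0 := right_ne_zero_of_mul hdiag
  have h10 : R 1 0 = 0 := hT (by decide)
  have h20 : R 2 0 = 0 := hT (by decide)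
  have h21 : R 2 1 = 0 := hT (by decide)
  let r : ℂ := -(R 0 1 / R 1 1)
  let t : ℂ := R 1 2 / R 2 2
  let s : ℂ := -r * t - R 0 2 / R 2 2
  have conj_eq (α β γ : ℂ) : R * !![α, 0, 0; 0, β, 0; 0, 0, γ] * R⁻¹ =
      !![α, r * (α - β), s * (α - γ) - r * t * (γ - β); 0, β, t * (γ - β); 0, 0, γ] := by
    let := R.invertibleOfIsUnitDet hdet
    rw [Matrix.mul_inv_eq_iff_eq_mul_of_invertible]
    ext i j
    fin_cases i <;> fin_cases j <;>
      simp [Matrix.mul_apply, Fin.sum_univ_three, h10, h20, h21, r, s, t] <;> field_simp <;> ring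
  refine ⟨r, s, t, Set.ext fun X => ⟨?_, ?_⟩⟩
  · rintro ⟨_, ⟨α, β, γ, rfl⟩, rfl⟩
    exact ⟨α, β, γ, conj_eq α β γ⟩
  · rintro ⟨α, β, γ, rfl⟩
    exact ⟨_, ⟨α, β, γ, rfl⟩, conj_eq α β γ⟩

/-- Lemma 5.2.5: every subalgebra of `M₃(ℂ)` similar to `𝒟` is unitarily equivalent
to some `𝒟ᵣₛₜ`. -/
theorem lemma_5_2_5 (A : Set (Mat 3)) (S : Mat 3) (hS : IsUnit S)
    (hA : A = (fun M => S⁻¹ * M * S) '' algD) :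
    ∃ (r s t : ℂ) (U : Mat 3), U ∈ Matrix.unitaryGroup (Fin 3) ℂ ∧
      (fun M => star U * M * U) '' A = algDrst r s t := by
  obtain ⟨U, hU, hT⟩ := exists_unitary_star_mul_isUpperTriangular S⁻¹
  have hdet : IsUnit S.det := (Matrix.isUnit_iff_isUnit_det S).mp hS
  have hUU : star U * U = 1 := Matrix.mem_unitaryGroup_iff'.mp hU
  have hinv : (star U * S⁻¹)⁻¹ = S * U := by
    refine Matrix.inv_eq_right_inv ?_
    rw [Matrix.mul_assoc, Matrix.nonsing_inv_mul_cancel_left _ _ hdet, hUU]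
  have hR : IsUnit (star U * S⁻¹) := by
    refine IsUnit.of_mul_eq_one (S * U) ?_
    rw [Matrix.mul_assoc, Matrix.nonsing_inv_mul_cancel_left _ _ hdet, hUU]
  obtain ⟨r, s, t, h⟩ := exists_image_conj_algD_eq_algDrst hR hT
  refine ⟨r, s, t, U, hU, ?_⟩
  rw [← h, hA, Set.image_image, hinv]
  simp only [Matrix.mul_assoc]
end

section
/- For all complex constants r, s, t, the subalgebra 𝒟_{rst} := { [[α, r(α−β), s(α−γ)−rt(γ−β)], [0, β, t(γ−β)], [0, 0, γ]] : α, β, γ ∈ ℂ } of M₃(ℂ) is not projection compressible. Consequently, no subalgebra of M₃(ℂ) similar to the algebra 𝒟 of all diagonal 3×3 matrices is projection compressible. -/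
open Matrix

/-- A vector `u` such that no coordinate of `S u` and of `u* T` vanishes. -/
lemma exists_mulVec_ne_zero_and_star_vecMul_ne_zero {S T : Mat 3} (h : S * T = 1) :
    ∃ u : Fin 3 → ℂ, (∀ i, (S *ᵥ u) i ≠ 0) ∧ ∀ j, (star u ᵥ* T) j ≠ 0 := by
  have hS : ∀ i, S i ≠ 0 := fun i hi => by
    have := congrFun (congrFun h i) i
    simp [mul_apply, hi] at this
  have hT : ∀ j, Tᴴ j ≠ 0 := fun j hj => by
    have := congrFun (congrFun h j) j
    have hj' : ∀ k, T k j = 0 := fun k => by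
      simpa [conjTranspose_apply] using congrFun hj k
    simp [mul_apply, hj'] at this
  obtain ⟨f, hf⟩ := Module.exists_dual_forall_apply_ne_zero (K := ℂ)
    (Sum.elim S Tᴴ : Fin 3 ⊕ Fin 3 → Fin 3 → ℂ) (by simpa using ⟨hS, hT⟩)
  have hdot : ∀ v : Fin 3 → ℂ, f v = v ⬝ᵥ fun i => f (Pi.single i 1) := fun v => by
    conv_lhs => rw [pi_eq_sum_univ' v]
    simp [dotProduct]
  refine ⟨fun i => f (Pi.single i 1), fun i => ?_, fun j => ?_⟩
  · exact fun hi => hf (.inl i) ((hdot _).trans hi)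
  · rw [← star_ne_zero, ← Pi.star_apply, star_vecMul, star_star]
    exact fun hj => hf (.inr j) ((hdot _).trans hj)

/-- A nonzero matrix with zero diagonal, annihilated by `g` on the left and by `w` on the right
when these vectors have no zero coordinate. -/
noncomputable def zeroDiagAnnihilator (g w : Fin 3 → ℂ) : Mat 3 :=
  of fun i j => (g i)⁻¹ * (!![0, 1, -1; -1, 0, 1; 1, -1, 0] : Mat 3) i j * (w j)⁻¹

lemma vecMul_zeroDiagAnnihilator {g : Fin 3 → ℂ} (w : Fin 3 → ℂ) (hg : ∀ i, g i ≠ 0) :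
    g ᵥ* zeroDiagAnnihilator g w = 0 := by
  have h0 := hg 0
  have h1 := hg 1
  have h2 := hg 2
  ext j
  fin_cases j <;> simp [zeroDiagAnnihilator, vecMul, dotProduct, Fin.sum_univ_three, h0, h1, h2]

lemma zeroDiagAnnihilator_mulVec (g : Fin 3 → ℂ) {w : Fin 3 → ℂ} (hw : ∀ i, w i ≠ 0) :
    zeroDiagAnnihilator g w *ᵥ w = 0 := by
  have h0 := hw 0
  have h1 := hw 1
  have h2 := hw 2
  ext j
  fin_cases j <;> simp [zeroDiagAnnihilator, mulVec, dotProduct, Fin.sum_univ_three, h0, h1, h2]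

/-- No algebra of the form `T 𝒟 S` with `S T = 1` is projection compressible. -/
lemma not_projectionCompressible_image_algD {S T : Mat 3} (h : S * T = 1) :
    ¬ ProjectionCompressible ((fun M => T * M * S) '' algD) := by
  obtain ⟨u, hw, hg⟩ := exists_mulVec_ne_zero_and_star_vecMul_ne_zero h
  set w := S *ᵥ u with hw_def
  set g := star u ᵥ* T with hg_def
  set c := star u ⬝ᵥ u with hc_def
  have hc : c ≠ 0 := by
    open ComplexOrder in rw [hc_def, Ne, dotProduct_star_self_eq_zero]
    rintro rfl
    exact hw 0 (by simp [hw_def])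
  have hcstar : star c = c := by
    simp [hc_def, dotProduct, mul_comm]
  set P : Mat 3 := 1 - c⁻¹ • vecMulVec u (star u) with hP
  have hPP : P * P = P := by
    have hu : vecMulVec u (star u) * vecMulVec u (star u) = c • vecMulVec u (star u) := by
      rw [vecMulVec_mul_vecMulVec, ← hc_def, vecMulVec_smul]
    simp [hP, mul_sub, sub_mul, hu, smul_smul, hc]
  have hPH : Pᴴ = P := by
    simp [hP, conjTranspose_vecMulVec, hcstar]
  set Q : Mat 3 := 1 - c⁻¹ • vecMulVec w g with hQ
  have hSPT : S * P * T = Q := by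
    simp [hP, hQ, mul_sub, sub_mul, h, mul_vecMulVec, vecMulVec_mul, hw_def, hg_def]
  set Y := zeroDiagAnnihilator g w with hY
  have hQY : Q * Y = Y := by
    simp [hQ, sub_mul, vecMulVec_mul, hY, vecMul_zeroDiagAnnihilator w hg]
  have hYQ : Y * Q = Y := by
    simp [hQ, mul_sub, mul_vecMulVec, hY, zeroDiagAnnihilator_mulVec g hw]
  intro hcomp
  obtain ⟨_, ⟨_, ⟨a, b, d, rfl⟩, rfl⟩, hD⟩ := hcomp P hPP hPH
    _ ⟨_, ⟨_, ⟨0, 1, 0, rfl⟩, rfl⟩, rfl⟩ _ ⟨_, ⟨_, ⟨1, 0, 0, rfl⟩, rfl⟩, rfl⟩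
  dsimp only at hD
  set D : Mat 3 := !![a, 0, 0; 0, b, 0; 0, 0, d] with hD_def
  set A : Mat 3 := !![0, 0, 0; 0, 1, 0; 0, 0, 0] with hA_def
  set B : Mat 3 := !![1, 0, 0; 0, 0, 0; 0, 0, 0] with hB_def
  have hconj : Q * D * Q = Q * A * Q * B * Q := by
    calc Q * D * Q = S * (P * (T * D * S) * P) * T := by simp only [← hSPT, Matrix.mul_assoc]
      _ = S * (P * (T * A * S) * (P * P) * (T * B * S) * P) * T := by
        rw [hD]; simp only [Matrix.mul_assoc]
      _ = Q * A * Q * B * Q := by rw [hPP]; simp only [← hSPT, Matrix.mul_assoc]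
  have htrace : (D * Y).trace = (A * Q * B * Y).trace := by
    have key : ∀ M : Mat 3, (Q * M * Q * Y).trace = (M * Y).trace := fun M => by
      rw [Matrix.mul_assoc, hQY, Matrix.mul_assoc, trace_mul_comm, Matrix.mul_assoc, hYQ]
    rw [← key, hconj, ← key (A * Q * B)]
    simp only [Matrix.mul_assoc]
  have hYdiag : ∀ i, Y i i = 0 := fun i => by
    fin_cases i <;> simp [hY, zeroDiagAnnihilator]
  have hY01 : Y 0 1 ≠ 0 := by simp [hY, zeroDiagAnnihilator, hg 0, hw 1]
  have hQ10 : Q 1 0 ≠ 0 := by simp [hQ, vecMulVec_apply, hc, hg 0, hw 1]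
  clear_value Y Q
  simp [hD_def, hA_def, hB_def, trace, vecMul, dotProduct, mul_apply, Fin.sum_univ_three,
    hYdiag, hY01, hQ10] at htrace

lemma algDrst_eq_image_algD (r s t : ℂ) :
    algDrst r s t = (fun M => !![1, -r, -s - r * t; 0, 1, t; 0, 0, 1] * M *
      !![1, r, s; 0, 1, -t; 0, 0, 1]) '' algD := by
  have key : ∀ α β γ : ℂ, !![1, -r, -s - r * t; 0, 1, t; 0, 0, 1] *
      !![α, 0, 0; 0, β, 0; 0, 0, γ] * !![1, r, s; 0, 1, -t; 0, 0, 1] =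
      !![α, r * (α - β), s * (α - γ) - r * t * (γ - β); 0, β, t * (γ - β); 0, 0, γ] := by
    intro α β γ
    ext i j
    fin_cases i <;> fin_cases j <;> simp [mul_apply, Fin.sum_univ_three] <;> ring
  ext M
  constructor
  · rintro ⟨α, β, γ, rfl⟩
    exact ⟨_, ⟨α, β, γ, rfl⟩, key α β γ⟩
  · rintro ⟨_, ⟨α, β, γ, rfl⟩, rfl⟩
    exact ⟨α, β, γ, key α β γ⟩

/-- Theorem 5.2.6: no `𝒟ᵣₛₜ` is projection compressible; consequently no algebra
similar to `𝒟` is projection compressible. -/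
theorem theorem_5_2_6 :
    (∀ r s t : ℂ, ¬ ProjectionCompressible (algDrst r s t)) ∧
    (∀ (A : Set (Mat 3)) (S : Mat 3), IsUnit S →
      A = (fun M => S⁻¹ * M * S) '' algD → ¬ ProjectionCompressible A) := by
  refine ⟨fun r s t => ?_, ?_⟩
  · rw [algDrst_eq_image_algD]
    refine not_projectionCompressible_image_algD ?_
    ext i j
    fin_cases i <;> fin_cases j <;> simp [mul_apply, Fin.sum_univ_three]
  · rintro _ S hS rfl
    exact not_projectionCompressible_image_algD
      (mul_nonsing_inv S ((isUnit_iff_isUnit_det S).mp hS))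
end

section
/- A unital subalgebra 𝒜 of M₃(ℂ) (i.e., a subalgebra containing the identity matrix I) is projection compressible if and only if it is idempotent compressible. -/
open Matrix

/-- If a traceless functional on `2 × 2` matrices kills two matrices but not their product,
then it is proportional to the trace pairing with their commutator, which is invertible. -/
theorem commutator_proportional {a b c d a' b' c' d' p q r : ℂ}
    (h1 : p * (a - d) + q * c + r * b = 0) (h2 : p * (a' - d') + q * c' + r * b' = 0)
    (h3 : p * (a * a' + b * c') + q * (c * a' + d * c') + r * (a * b' + b * d')
      - p * (c * b' + d * d') ≠ 0) :
    let x := b * c' - b' * c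
    let y := a * b' + b * d' - a' * b - b' * d
    let z := c * a' + d * c' - c' * a - d' * c
    (x ^ 2 + y * z ≠ 0) ∧ ∃ m : ℂ, x = m * p ∧ y = m * q ∧ z = m * r := by
  intro x y z
  have e1 : x * q = y * p := by grind
  have e2 : x * r = z * p := by grind
  have e3 : y * r = z * q := by grind
  have h4 : 2 * (p * x) + q * z + r * y ≠ 0 := by
    grind
  have h5 : (2 * (p * x) + q * z + r * y) ^ 2 = 4 * (p ^ 2 + q * r) * (x ^ 2 + y * z) := by grind
  have h6 : p ^ 2 + q * r ≠ 0 := by grind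
  refine ⟨by grind, (2 * (p * x) + q * z + r * y) / (2 * (p ^ 2 + q * r)), ?_, ?_, ?_⟩
  · field_simp; grind
  · field_simp; grind
  · field_simp; grind

theorem commutator_sq_trace_zero {P a b : Mat 3} (hP : P * P = P)
    (ha : P * a * P = a) (hb : P * b * P = b)
    {α β γ : ℂ} (h : a * b - b * a = α • P + β • a + γ • b) :
    trace ((a * b - b * a) * (a * b - b * a)) = 0 := by
  have hPa : P * a = a := by rw [← ha]; simp only [← mul_assoc, hP]
  have hPb : P * b = b := by rw [← hb]; simp only [← mul_assoc, hP]
  have h1 : trace ((a * b - b * a) * a) = 0 := by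
    rw [sub_mul, trace_sub, mul_assoc a b a, trace_mul_comm, sub_self]
  have h2 : trace ((a * b - b * a) * b) = 0 := by
    rw [sub_mul, trace_sub, mul_assoc b a b, trace_mul_comm b, sub_self]
  have h0 : trace ((a * b - b * a) * P) = 0 := by
    rw [trace_mul_comm, mul_sub, ← mul_assoc, ← mul_assoc, hPa, hPb, trace_sub, trace_mul_comm,
      sub_self]
  nth_rw 2 [h]
  simp [mul_add, h0, h1, h2]

theorem idempotent_diagonalizable (E : Mat 3) (hE : E * E = E) :
    ∃ (g : (Mat 3)ˣ) (d : Fin 3 → ℂ), E = g * diagonal d * (g⁻¹ : (Mat 3)ˣ) ∧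
      (d = 0 ∨ d = 1 ∨ d = ![1, 0, 0] ∨ d = ![1, 1, 0]) := by
  set f := Matrix.toLin' E with hf
  have hff : IsIdempotentElem f := by
    unfold IsIdempotentElem
    rw [hf, Module.End.mul_eq_comp, ← Matrix.toLin'_mul, hE]
  have hc := LinearMap.IsIdempotentElem.isCompl hff
  have hdim : Module.finrank ℂ f.range + Module.finrank ℂ f.ker = 3 := by
    simpa using f.finrank_range_add_finrank_ker
  have key : ∀ k l : ℕ, Module.finrank ℂ f.range = k → Module.finrank ℂ f.ker = l →
      ∀ e : Fin k ⊕ Fin l ≃ Fin 3, ∃ g : (Mat 3)ˣ,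
        E = g * diagonal (fun i => Sum.elim (fun _ => (1 : ℂ)) (fun _ => 0) (e.symm i))
          * (g⁻¹ : (Mat 3)ˣ) := by
    intro k l hk hl e
    let b := (((Module.finBasisOfFinrankEq ℂ f.range hk).prod
      (Module.finBasisOfFinrankEq ℂ f.ker hl)).map
        (Submodule.prodEquivOfIsCompl _ _ hc)).reindex e
    have hb : ∀ i, E *ᵥ b i = Sum.elim (fun _ => (1 : ℂ)) (fun _ => 0) (e.symm i) • b i := by
      intro i
      change f (b i) = _
      obtain ⟨i, rfl⟩ := e.surjective i
      rcases i with i | i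
      · simpa [b] using (LinearMap.IsIdempotentElem.mem_range_iff hff).1 (Subtype.mem _)
      · simp [b]
    have hu : IsUnit ((Pi.basisFun ℂ (Fin 3)).toMatrix b) := by
      have := (Pi.basisFun ℂ (Fin 3)).invertibleToMatrix b
      exact isUnit_of_invertible _
    obtain ⟨g, hg⟩ := hu
    refine ⟨g, ?_⟩
    rw [Units.eq_mul_inv_iff_mul_eq]
    ext i j
    have := congrFun (hb j) i
    rw [mul_diagonal, hg]
    simpa [Matrix.mul_apply, mulVec, dotProduct, Module.Basis.toMatrix_apply, mul_comm] using this
  obtain ⟨k, hk⟩ : ∃ k, k = Module.finrank ℂ f.range := ⟨_, rfl⟩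
  obtain ⟨l, hl⟩ : ∃ l, l = Module.finrank ℂ f.ker := ⟨_, rfl⟩
  have hkl : k + l = 3 := by omega
  have hk3 : k ≤ 3 := by omega
  have hl3 : l = 3 - k := by omega
  subst hl3
  obtain ⟨g, hg⟩ := key k _ hk.symm hl.symm (finSumFinEquiv.trans (finCongr hkl))
  refine ⟨g, _, hg, ?_⟩
  clear hg hk hl
  interval_cases k
  · left; funext i; fin_cases i <;> rfl
  · right; right; left; funext i; fin_cases i <;> rfl
  · right; right; right; funext i; fin_cases i <;> rfl
  · right; left; funext i; fin_cases i <;> rfl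

theorem eq_zero_of_pairing {l₁ l₂ m₁ m₂ r₁ r₂ s₁ s₂ n₁ n₂ δ : ℂ} (hδ : δ ≠ 0)
    (h1 : l₁ * r₁ + l₂ * r₂ = 0) (h2 : l₁ * s₁ + l₂ * s₂ = -δ)
    (h3 : m₁ * r₁ + m₂ * r₂ = δ)
    (hl : l₁ * n₁ + l₂ * n₂ = 0) (hm : m₁ * n₁ + m₂ * n₂ = 0) : n₁ = 0 ∧ n₂ = 0 := by
  have h : (l₁ * m₂ - l₂ * m₁) * (r₁ * s₂ - r₂ * s₁) = δ ^ 2 := by grind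
  have hd : l₁ * m₂ - l₂ * m₁ ≠ 0 := by
    intro h0
    rw [h0, zero_mul] at h
    exact hδ (pow_eq_zero_iff two_ne_zero |>.1 h.symm)
  constructor
  · apply (mul_eq_zero.1 (_ : (l₁ * m₂ - l₂ * m₁) * n₁ = 0)).resolve_left hd
    linear_combination m₂ * hl - l₂ * hm
  · apply (mul_eq_zero.1 (_ : (l₁ * m₂ - l₂ * m₁) * n₂ = 0)).resolve_left hd
    linear_combination l₁ * hm - m₁ * hl

theorem eq_zero_of_corner_eq_zero (S : Subalgebra ℂ (Mat 3)) {A B N : Mat 3} (hA : A ∈ S)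
    (hB : B ∈ S) (hN : N ∈ S) {x y z : ℂ}
    (hx : x = A 0 1 * B 1 0 - B 0 1 * A 1 0)
    (hy : y = A 0 0 * B 0 1 + A 0 1 * B 1 1 - B 0 0 * A 0 1 - B 0 1 * A 1 1)
    (hz : z = A 1 0 * B 0 0 + A 1 1 * B 1 0 - B 1 0 * A 0 0 - B 1 1 * A 1 0)
    (hδ : x ^ 2 + y * z ≠ 0)
    (hS : ∀ M ∈ S, x * (M 0 0 - M 1 1) + y * M 1 0 + z * M 0 1 = 0)
    (h00 : N 0 0 = 0) (h01 : N 0 1 = 0) (h10 : N 1 0 = 0) (h11 : N 1 1 = 0) : N = 0 := by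
  have key : ∀ {N : Mat 3}, N ∈ S → N 0 0 = 0 → N 0 1 = 0 → N 1 0 = 0 → N 1 1 = 0 →
      (N 2 0 = 0 ∧ N 2 1 = 0) ∧ N 0 2 = 0 ∧ N 1 2 = 0 := by
    intro N hN h00 h01 h10 h11
    have a0 := hS A hA
    have b0 := hS B hB
    have aa := hS _ (S.mul_mem hA hA)
    have ab := hS _ (S.mul_mem hA hB)
    have ba := hS _ (S.mul_mem hB hA)
    have an := hS _ (S.mul_mem hA hN)
    have bn := hS _ (S.mul_mem hB hN)
    have na := hS _ (S.mul_mem hN hA)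
    have nb := hS _ (S.mul_mem hN hB)
    simp only [Matrix.mul_apply, Fin.sum_univ_three, h00, h01, h10, h11] at aa ab ba an bn na nb
    constructor
    · refine eq_zero_of_pairing (l₁ := x * A 0 2 + y * A 1 2) (l₂ := z * A 0 2 - x * A 1 2)
        (m₁ := x * B 0 2 + y * B 1 2) (m₂ := z * B 0 2 - x * B 1 2)
        (r₁ := A 2 0) (r₂ := A 2 1) (s₁ := B 2 0) (s₂ := B 2 1) hδ ?_ ?_ ?_ ?_ ?_
      · linear_combination aa - (A 0 0 + A 1 1) * a0
      · grind
      · grind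
      · linear_combination an
      · linear_combination bn
    · refine eq_zero_of_pairing (l₁ := x * B 2 0 + z * B 2 1) (l₂ := y * B 2 0 - x * B 2 1)
        (m₁ := x * A 2 0 + z * A 2 1) (m₂ := y * A 2 0 - x * A 2 1)
        (r₁ := B 0 2) (r₂ := B 1 2) (s₁ := A 0 2) (s₂ := A 1 2) hδ ?_ ?_ ?_ ?_ ?_
      · have bb := hS _ (S.mul_mem hB hB)
        simp only [Matrix.mul_apply, Fin.sum_univ_three] at bb
        linear_combination bb - (B 0 0 + B 1 1) * b0
      · grind
      · grind
      · linear_combination nb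
      · linear_combination na
  obtain ⟨⟨h20, h21⟩, h02, h12⟩ := key hN h00 h01 h10 h11
  by_cases h22 : N 2 2 = 0
  · ext i j
    fin_cases i <;> fin_cases j <;> assumption
  exfalso
  have hNA : A 2 0 = 0 ∧ A 2 1 = 0 := by
    have := (key (S.mul_mem hN hA) (by simp [Matrix.mul_apply, Fin.sum_univ_three, *])
      (by simp [Matrix.mul_apply, Fin.sum_univ_three, *])
      (by simp [Matrix.mul_apply, Fin.sum_univ_three, *])
      (by simp [Matrix.mul_apply, Fin.sum_univ_three, *])).1
    simpa [Matrix.mul_apply, Fin.sum_univ_three, h20, h21, h22] using this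
  have a0 := hS A hA
  have b0 := hS B hB
  have ba := hS _ (S.mul_mem hB hA)
  simp only [Matrix.mul_apply, Fin.sum_univ_three, hNA.1, hNA.2] at ba
  apply hδ
  grind

theorem exists_smul_one_add_smul_add_smul (S : Subalgebra ℂ (Mat 3)) {A B C : Mat 3} (hA : A ∈ S)
    (hB : B ∈ S) (hC : C ∈ S) {x y z : ℂ}
    (hx : x = A 0 1 * B 1 0 - B 0 1 * A 1 0)
    (hy : y = A 0 0 * B 0 1 + A 0 1 * B 1 1 - B 0 0 * A 0 1 - B 0 1 * A 1 1)
    (hz : z = A 1 0 * B 0 0 + A 1 1 * B 1 0 - B 1 0 * A 0 0 - B 1 1 * A 1 0)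
    (hδ : x ^ 2 + y * z ≠ 0)
    (hS : ∀ M ∈ S, x * (M 0 0 - M 1 1) + y * M 1 0 + z * M 0 1 = 0) :
    ∃ α β γ : ℂ, C = α • 1 + β • A + γ • B := by
  obtain ⟨β, hβ⟩ : ∃ β : ℂ, β * (2 * (x ^ 2 + y * z)) =
      (C 0 0 - C 1 1) * (B 0 1 * z - y * B 1 0) + C 1 0 * ((B 0 0 - B 1 1) * y - 2 * x * B 0 1)
        + C 0 1 * (2 * x * B 1 0 - z * (B 0 0 - B 1 1)) :=
    ⟨_, div_mul_cancel₀ _ (mul_ne_zero two_ne_zero hδ)⟩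
  obtain ⟨γ, hγ⟩ : ∃ γ : ℂ, γ * (2 * (x ^ 2 + y * z)) =
      -((C 0 0 - C 1 1) * (A 0 1 * z - y * A 1 0) + C 1 0 * ((A 0 0 - A 1 1) * y - 2 * x * A 0 1)
        + C 0 1 * (2 * x * A 1 0 - z * (A 0 0 - A 1 1))) :=
    ⟨_, div_mul_cancel₀ _ (mul_ne_zero two_ne_zero hδ)⟩
  have c0 := hS C hC
  have h01 : C 0 1 - β * A 0 1 - γ * B 0 1 = 0 := by
    refine (mul_eq_zero_iff_left (mul_ne_zero two_ne_zero hδ)).1 ?_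
    grind
  have h10 : C 1 0 - β * A 1 0 - γ * B 1 0 = 0 := by
    refine (mul_eq_zero_iff_left (mul_ne_zero two_ne_zero hδ)).1 ?_
    grind
  have h11 : C 1 1 - (C 0 0 - β * A 0 0 - γ * B 0 0) - β * A 1 1 - γ * B 1 1 = 0 := by
    refine (mul_eq_zero_iff_left (mul_ne_zero two_ne_zero hδ)).1 ?_
    grind
  refine ⟨C 0 0 - β * A 0 0 - γ * B 0 0, β, γ, ?_⟩
  have hN : C - (C 0 0 - β * A 0 0 - γ * B 0 0) • (1 : Mat 3) - β • A - γ • B ∈ S :=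
    S.sub_mem (S.sub_mem (S.sub_mem hC (S.smul_mem S.one_mem _)) (S.smul_mem hA _))
      (S.smul_mem hB _)
  have := eq_zero_of_corner_eq_zero S hA hB hN hx hy hz hδ hS (by simp; ring)
    (by simpa using h01) (by simpa using h10) (by simpa using h11)
  rwa [sub_sub, sub_sub, sub_eq_zero, ← add_assoc] at this

/-- The commutator of the compressions of `A` and `B` by `E`. -/
def compressedCommutator {R : Type*} [CommRing R] (E A B : Matrix (Fin 3) (Fin 3) R) :
    Matrix (Fin 3) (Fin 3) R :=
  E * A * E * (E * B * E) - E * B * E * (E * A * E)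

theorem span_of_not_mulClosed_compress_diagonal (S : Subalgebra ℂ (Mat 3))
    (h : ¬ MulClosed (compress (diagonal ![1, 1, 0]) (S : Set (Mat 3)))) :
    ∃ A ∈ S, ∃ B ∈ S, (∀ C ∈ S, ∃ α β γ : ℂ, C = α • 1 + β • A + γ • B) ∧
      trace (compressedCommutator (diagonal ![1, 1, 0]) A B *
        compressedCommutator (diagonal ![1, 1, 0]) A B) ≠ 0 := by
  set D : Mat 3 := diagonal ![1, 1, 0] with hD
  have hcorner : ∀ M : Mat 3, D * M * D = M 0 0 • single 0 0 1 + M 0 1 • single 0 1 1 +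
      M 1 0 • single 1 0 1 + M 1 1 • single 1 1 1 := by
    intro M
    ext i j
    fin_cases i <;> fin_cases j <;> simp [hD]
  simp only [MulClosed, compress, Set.forall_mem_image, not_forall] at h
  obtain ⟨A, hA, B, hB, hAB⟩ := h
  have hAB' : D * A * D * (D * B * D) = D * (A * D * B) * D := by
    have : D * D = D := by simp [hD, diagonal_mul_diagonal]; congr! 2 with i; fin_cases i <;> simp
    simp only [mul_assoc, ← mul_assoc D D, this]
  rw [hAB'] at hAB
  let L : Mat 3 →ₗ[ℂ] Mat 3 := LinearMap.mulRight ℂ D ∘ₗ LinearMap.mulLeft ℂ D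
  obtain ⟨f, hf, hSf⟩ := Submodule.exists_le_ker_of_notMem (K := ℂ)
    (p := (Subalgebra.toSubmodule S).map L) (v := D * (A * D * B) * D) hAB
  have hf0 : ∀ M ∈ S, f (D * M * D) = 0 := fun M hM => hSf ⟨M, hM, rfl⟩
  simp only [hcorner, map_add, map_smul, smul_eq_mul] at hf hf0
  have h1 := hf0 1 S.one_mem
  simp only [one_apply_eq, ne_eq, zero_ne_one, one_ne_zero, not_false_eq_true, one_apply_ne] at h1
  have h11 : f (single 1 1 1) = - f (single 0 0 1) := by linear_combination h1
  rw [h11] at hf hf0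
  simp only [hD, Matrix.mul_apply, Fin.sum_univ_three] at hf
  obtain ⟨hδ, m, hx, hy, hz⟩ := commutator_proportional (p := f (single 0 0 1))
    (q := f (single 1 0 1)) (r := f (single 0 1 1))
    (a := A 0 0) (b := A 0 1) (c := A 1 0) (d := A 1 1) (a' := B 0 0) (b' := B 0 1) (c' := B 1 0)
    (d' := B 1 1) (by linear_combination hf0 A hA) (by linear_combination hf0 B hB) (by
      intro h0
      apply hf
      simp
      linear_combination h0)
  refine ⟨A, hA, B, hB, fun C hC => ?_, ?_⟩
  · refine exists_smul_one_add_smul_add_smul S hA hB hC rfl rfl rfl hδ fun M hM => ?_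
    rw [hx, hy, hz]
    linear_combination m * hf0 M hM
  · intro h0
    apply hδ
    simp only [compressedCommutator, hcorner, trace_fin_three] at h0
    simp [Matrix.mul_apply, Fin.sum_univ_three, single_apply] at h0
    grind

theorem mulClosed_compress_of_mul_mul {E : Mat 3} (S : Subalgebra ℂ (Mat 3))
    (h : ∀ A ∈ S, ∀ B ∈ S, ∃ C ∈ S, E * A * E * (E * B * E) = E * C * E) :
    MulClosed (compress E (S : Set (Mat 3))) := by
  rintro _ ⟨A, hA, rfl⟩ _ ⟨B, hB, rfl⟩
  obtain ⟨C, hC, hCE⟩ := h A hA B hB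
  exact ⟨C, hC, hCE.symm⟩

theorem span_of_not_mulClosed_compress (S : Subalgebra ℂ (Mat 3)) {E : Mat 3} (hE : E * E = E)
    (h : ¬ MulClosed (compress E (S : Set (Mat 3)))) :
    (∃ u v : Fin 3 → ℂ, E = (u ⬝ᵥ v) • (1 : Mat 3) - vecMulVec u v) ∧
    ∃ A ∈ S, ∃ B ∈ S, (∀ C ∈ S, ∃ α β γ : ℂ, C = α • 1 + β • A + γ • B) ∧
      trace (compressedCommutator E A B * compressedCommutator E A B) ≠ 0 := by
  obtain ⟨g, d, rfl, hd⟩ := idempotent_diagonalizable E hE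
  let φ : Mat 3 ≃ₐ[ℂ] Mat 3 := MulSemiringAction.toAlgEquiv ℂ (Mat 3) (ConjAct.toConjAct g)
  have hφ : ∀ M, φ M = g * M * (g⁻¹ : (Mat 3)ˣ) := fun M => ConjAct.units_smul_def _ _
  rw [← hφ] at h ⊢
  have hD : ¬ MulClosed (compress (diagonal d) (S.comap φ.toAlgHom : Set (Mat 3))) := by
    intro hc
    apply h
    refine mulClosed_compress_of_mul_mul S fun A hA B hB => ?_
    obtain ⟨C, hC, hCE⟩ := hc _ ⟨φ.symm A, by simpa using hA, rfl⟩ _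
      ⟨φ.symm B, by simpa using hB, rfl⟩
    refine ⟨φ C, hC, ?_⟩
    simpa using congrArg φ hCE.symm
  have hd' : d = ![1, 1, 0] := by
    rcases hd with rfl | rfl | rfl | rfl
    · exact absurd (mulClosed_compress_of_mul_mul _ fun A _ B _ => ⟨0, zero_mem _, by simp⟩) hD
    · exact absurd (mulClosed_compress_of_mul_mul _ fun A hA B hB =>
        ⟨A * B, mul_mem hA hB, by simp⟩) hD
    · refine absurd (mulClosed_compress_of_mul_mul _ fun A _ B hB =>
        ⟨A 0 0 • B, Subalgebra.smul_mem _ hB _, ?_⟩) hD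
      ext i j
      fin_cases i <;> fin_cases j <;> simp [Matrix.mul_apply, Fin.sum_univ_three, diagonal]
    · rfl
  subst hd'
  obtain ⟨A, hA, B, hB, hspan, htr⟩ := span_of_not_mulClosed_compress_diagonal _ hD
  refine ⟨⟨g *ᵥ Pi.single (2 : Fin 3) 1, Pi.single (2 : Fin 3) 1 ᵥ* (g⁻¹ : (Mat 3)ˣ), ?_⟩,
    φ A, hA, φ B, hB, fun C hC => ?_, ?_⟩
  · have h1 : diagonal ![1, 1, 0] = (1 : Mat 3) - vecMulVec (Pi.single 2 1) (Pi.single 2 1) := by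
      ext i j
      fin_cases i <;> fin_cases j <;> simp [vecMulVec_apply]
    rw [hφ, h1, mul_sub, sub_mul, mul_vecMulVec, vecMulVec_mul, dotProduct_comm, ← dotProduct_mulVec,
      mulVec_mulVec]
    simp
  · obtain ⟨α, β, γ, h⟩ := hspan (φ.symm C) (by simpa using hC)
    exact ⟨α, β, γ, by simpa using congrArg φ h⟩
  · have : compressedCommutator (φ (diagonal ![1, 1, 0])) (φ A) (φ B) =
        φ (compressedCommutator (diagonal ![1, 1, 0]) A B) := by simp [compressedCommutator]
    rwa [this, ← map_mul, hφ, Matrix.trace_units_conj]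

/-- The matrix `(u ⬝ᵥ v) • 1 - u vᵀ`, which for `u ⬝ᵥ v ≠ 0` is a multiple of the idempotent with
kernel spanned by `u` whose range is the annihilator of `v`. -/
def scaledIdempotent {R : Type*} [CommRing R] (u v : Fin 3 → R) : Matrix (Fin 3) (Fin 3) R :=
  (u ⬝ᵥ v) • (1 : Matrix (Fin 3) (Fin 3) R) - vecMulVec u v

theorem map_trace_compressedCommutator {R R' : Type*} [CommRing R] [CommRing R'] (f : R →+* R')
    (u v : Fin 3 → R) (A B : Matrix (Fin 3) (Fin 3) R) :
    f (trace (compressedCommutator (scaledIdempotent u v) A B *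
      compressedCommutator (scaledIdempotent u v) A B)) =
    trace (compressedCommutator (scaledIdempotent (f ∘ u) (f ∘ v)) (f.mapMatrix A)
      (f.mapMatrix B) * compressedCommutator (scaledIdempotent (f ∘ u) (f ∘ v)) (f.mapMatrix A)
      (f.mapMatrix B)) := by
  have h : f.mapMatrix (scaledIdempotent u v) = scaledIdempotent (f ∘ u) (f ∘ v) := by
    ext i j
    simp [scaledIdempotent, vecMulVec_apply, one_apply, apply_ite f, dotProduct]
  rw [AddMonoidHom.map_trace, ← h]
  congr 1
  change f.mapMatrix _ = _
  simp only [compressedCommutator, map_mul, map_sub]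

/-- The pairs `(u, star u)` are Zariski dense in the pairs `(u, v)`. -/
theorem trace_compressedCommutator_eq_zero {A B : Mat 3}
    (h : ∀ u : Fin 3 → ℂ, trace (compressedCommutator (scaledIdempotent u (star u)) A B *
      compressedCommutator (scaledIdempotent u (star u)) A B) = 0) (u v : Fin 3 → ℂ) :
    trace (compressedCommutator (scaledIdempotent u v) A B *
      compressedCommutator (scaledIdempotent u v) A B) = 0 := by
  let s : Fin 3 → ℂ := fun i => (u i + v i) / 2
  let t : Fin 3 → ℂ := fun i => (u i - v i) / (2 * Complex.I)
  let s' : Fin 3 → Polynomial ℂ := fun i =>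
    Polynomial.C ((s i).re : ℂ) + Polynomial.C ((s i).im : ℂ) * Polynomial.X
  let t' : Fin 3 → Polynomial ℂ := fun i =>
    Polynomial.C ((t i).re : ℂ) + Polynomial.C ((t i).im : ℂ) * Polynomial.X
  let u' : Fin 3 → Polynomial ℂ := fun i => s' i + Polynomial.C Complex.I * t' i
  let v' : Fin 3 → Polynomial ℂ := fun i => s' i - Polynomial.C Complex.I * t' i
  let F : Polynomial ℂ := trace (compressedCommutator (scaledIdempotent u' v')
    ((Polynomial.C).mapMatrix A) ((Polynomial.C).mapMatrix B) * compressedCommutator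
      (scaledIdempotent u' v') ((Polynomial.C).mapMatrix A) ((Polynomial.C).mapMatrix B))
  have hC : ∀ (z : ℂ) (M : Mat 3),
      (Polynomial.evalRingHom z).mapMatrix ((Polynomial.C).mapMatrix M) = M := by
    intro z M
    ext i j
    simp
  have hF : ∀ z : ℂ, F.eval z = trace (compressedCommutator (scaledIdempotent
      (Polynomial.evalRingHom z ∘ u') (Polynomial.evalRingHom z ∘ v')) A B * compressedCommutator
      (scaledIdempotent (Polynomial.evalRingHom z ∘ u') (Polynomial.evalRingHom z ∘ v')) A B) := by
    intro z
    rw [← Polynomial.coe_evalRingHom, map_trace_compressedCommutator, hC, hC]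
  have hF0 : F = 0 := by
    refine Polynomial.eq_zero_of_infinite_isRoot F
      ((Set.infinite_range_of_injective Complex.ofReal_injective).mono ?_)
    rintro _ ⟨x, rfl⟩
    change F.eval (x : ℂ) = 0
    have hv : Polynomial.evalRingHom (x : ℂ) ∘ v' = star (Polynomial.evalRingHom (x : ℂ) ∘ u') := by
      ext i
      simp [u', v', s', t']
      ring
    rw [hF, hv, h]
  have hu : Polynomial.evalRingHom Complex.I ∘ u' = u := by
    ext i
    simp only [Function.comp_apply, u', s', t', Polynomial.coe_evalRingHom, Polynomial.eval_add,
      Polynomial.eval_mul, Polynomial.eval_C, Polynomial.eval_X, Complex.re_add_im]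
    simp only [s, t]
    field_simp
    ring
  have hv : Polynomial.evalRingHom Complex.I ∘ v' = v := by
    ext i
    simp only [Function.comp_apply, v', s', t', Polynomial.coe_evalRingHom, Polynomial.eval_add,
      Polynomial.eval_sub, Polynomial.eval_mul, Polynomial.eval_C, Polynomial.eval_X,
      Complex.re_add_im]
    simp only [s, t]
    field_simp
    ring
  have := hF Complex.I
  rwa [hF0, Polynomial.eval_zero, hu, hv, eq_comm] at this

theorem trace_compressedCommutator_eq_zero_of_mulClosed {S : Subalgebra ℂ (Mat 3)} {P A B : Mat 3}
    (hP : P * P = P) (hA : A ∈ S) (hB : B ∈ S)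
    (hspan : ∀ C ∈ S, ∃ α β γ : ℂ, C = α • 1 + β • A + γ • B)
    (h : MulClosed (compress P (S : Set (Mat 3)))) :
    trace (compressedCommutator P A B * compressedCommutator P A B) = 0 := by
  obtain ⟨C, hC, hCP⟩ := h _ ⟨A, hA, rfl⟩ _ ⟨B, hB, rfl⟩
  obtain ⟨C', hC', hCP'⟩ := h _ ⟨B, hB, rfl⟩ _ ⟨A, hA, rfl⟩
  obtain ⟨α, β, γ, hCC⟩ := hspan _ (S.sub_mem hC hC')
  refine commutator_sq_trace_zero hP (α := α) (β := β) (γ := γ) ?_ ?_ ?_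
  · simp only [mul_assoc, hP]
    simp only [← mul_assoc, hP]
  · simp only [mul_assoc, hP]
    simp only [← mul_assoc, hP]
  · dsimp only at hCP hCP'
    rw [← hCP, ← hCP', ← sub_mul, ← mul_sub, hCC]
    simp [mul_add, add_mul, hP]

theorem trace_compressedCommutator_scaledIdempotent_star {S : Subalgebra ℂ (Mat 3)} {A B : Mat 3}
    (hA : A ∈ S) (hB : B ∈ S) (hspan : ∀ C ∈ S, ∃ α β γ : ℂ, C = α • 1 + β • A + γ • B)
    (h : ProjectionCompressible (S : Set (Mat 3))) (u : Fin 3 → ℂ) :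
    trace (compressedCommutator (scaledIdempotent u (star u)) A B *
      compressedCommutator (scaledIdempotent u (star u)) A B) = 0 := by
  rcases eq_or_ne u 0 with rfl | hu
  · simp [compressedCommutator, scaledIdempotent]
  set c := u ⬝ᵥ star u with hc
  have hc0 : c ≠ 0 := by
    open scoped ComplexOrder in rwa [hc, ne_eq, dotProduct_self_star_eq_zero]
  have hcs : star c = c := by rw [hc, ← dotProduct_star]
  set Q := scaledIdempotent u (star u) with hQ
  have hQQ : Q * Q = c • Q := by
    simp only [hQ, scaledIdempotent, ← hc, sub_mul, mul_sub, vecMulVec_mul_vecMulVec]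
    simp [dotProduct_comm (star u), ← hc, smul_sub]
  have hQs : Qᴴ = Q := by
    simp [hQ, scaledIdempotent, ← hc, conjTranspose_vecMulVec, hcs]
  have hP : (c⁻¹ • Q) * (c⁻¹ • Q) = c⁻¹ • Q := by
    simp [hQQ, smul_smul, hc0]
  have hPs : (c⁻¹ • Q)ᴴ = c⁻¹ • Q := by
    rw [conjTranspose_smul, hQs, star_inv₀, hcs]
  have := trace_compressedCommutator_eq_zero_of_mulClosed hP hA hB hspan (h _ hP hPs)
  have hQP : compressedCommutator (c⁻¹ • Q) A B = (c⁻¹ ^ 4) • compressedCommutator Q A B := by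
    simp only [compressedCommutator, smul_mul_assoc, mul_smul_comm, smul_smul, smul_sub]
    ring_nf
  rw [hQP] at this
  simpa [hc0] using this

/-- A unital subalgebra of `M₃(ℂ)` is projection compressible if and only if it is
idempotent compressible. -/
theorem unital_proj_iff_idem_compressible (A : Subalgebra ℂ (Mat 3)) :
    ProjectionCompressible (A : Set (Mat 3)) ↔ IdempotentCompressible (A : Set (Mat 3)) := by
  refine ⟨fun h E hE => ?_, fun h P hP _ => h P hP⟩
  by_contra hne
  obtain ⟨⟨u, v, rfl⟩, M, hM, N, hN, hspan, htr⟩ := span_of_not_mulClosed_compress A hE hne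
  exact htr (trace_compressedCommutator_eq_zero
    (trace_compressedCommutator_scaledIdempotent_star hM hN hspan h) u v)
end
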